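/- Let Q be a non-degenerate rational quadric in the plane and let ψ be an approximating function. If ∑_{h=1}^∞ ψ(h)² < ∞ then ℋ¹(Q ∩ S₂(ψ)) = 0, while if ∑_{h=1}^∞ ψ(h)² = ∞ then ℋ¹(Q \ S₂(ψ)) = 0 (i.e. the set Q ∩ S₂(ψ) has full induced measure on Q). -/

import Mathlib

open MeasureTheory Filter

/-- The distance from a real number to the nearest integer. -/
noncomputable def distNearestInt (x : ℝ) : ℝ := |x - round x|

/-- An approximating function: a decreasing function `ℝ₊ → ℝ₊` taking positive values. -/
def IsApproxFun (ψ : ℝ → ℝ) : Prop :=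
  (∀ x y : ℝ, 0 < x → x ≤ y → ψ y ≤ ψ x) ∧ ∀ x : ℝ, 0 < x → 0 < ψ x

/-- The set `S₂(ψ)` of simultaneously `ψ`-approximable points of the plane. -/
def SimApprox2 (ψ : ℝ → ℝ) : Set (ℝ × ℝ) :=
  {y : ℝ × ℝ |
    {q : ℕ | 0 < q ∧
      max (distNearestInt (q * y.1)) (distNearestInt (q * y.2)) < ψ q}.Infinite}

/-- A non-degenerate rational quadric in the plane: the image of the unit circle,
the standard parabola, or the standard hyperbola under an invertible affine
transformation of the plane with rational coefficients. -/
def IsRatQuadric (Q : Set (ℝ × ℝ)) : Prop :=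
  ∃ a b c d e g : ℚ, a * d - b * c ≠ 0 ∧
    ∃ S : Set (ℝ × ℝ),
      (S = {p : ℝ × ℝ | p.1 ^ 2 + p.2 ^ 2 = 1} ∨
       S = {p : ℝ × ℝ | p.2 = p.1 ^ 2} ∨
       S = {p : ℝ × ℝ | p.1 ^ 2 - p.2 ^ 2 = 1}) ∧
      Q = (fun p : ℝ × ℝ =>
        ((a : ℝ) * p.1 + (b : ℝ) * p.2 + (e : ℝ),
         (c : ℝ) * p.1 + (d : ℝ) * p.2 + (g : ℝ))) '' S

lemma Finset.card_le_mul_of_fiber_le {α β : Type*} [DecidableEq β] (s : Finset α) (f : α → β)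
    {X Y : ℝ} (hX0 : 0 ≤ X) (hX : ∀ c, ((s.filter (fun x => f x = c)).card : ℝ) ≤ X)
    (hY : ((s.image f).card : ℝ) ≤ Y) : (s.card : ℝ) ≤ Y * X := by
  have h := Finset.card_eq_sum_card_image f s
  rw [h]
  push_cast
  calc ∑ c ∈ s.image f, ((s.filter (fun x => f x = c)).card : ℝ)
      ≤ ∑ c ∈ s.image f, X := Finset.sum_le_sum fun c _ => hX c
    _ = (s.image f).card * X := by simp
    _ ≤ Y * X := by gcongr

lemma card_le_of_dvd_sub_of_abs_sub_le (F : Finset ℤ) (d : ℤ) (hd : 0 < d) {W : ℝ} (hW : 0 ≤ W)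
    (hF : ∀ x ∈ F, ∀ y ∈ F, d ∣ x - y ∧ |((x - y : ℤ) : ℝ)| ≤ W) :
    (F.card : ℝ) ≤ W / d + 1 := by
  have hd' : (0 : ℝ) < d := by exact_mod_cast hd
  rcases F.eq_empty_or_nonempty with rfl | hne
  · simp; positivity
  set x₀ := F.min' hne
  have hx₀ : x₀ ∈ F := F.min'_mem hne
  have hmap : ∀ x ∈ F, (x - x₀) / d ∈ Finset.Icc (0 : ℤ) ⌊W / d⌋ := by
    intro x hx
    have h0 : 0 ≤ x - x₀ := sub_nonneg.2 (F.min'_le x hx)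
    obtain ⟨⟨e, he⟩, h2⟩ := hF x hx x₀ hx₀
    rw [he, Int.mul_ediv_cancel_left _ hd.ne', Finset.mem_Icc]
    rw [he] at h0 h2
    refine ⟨by nlinarith, Int.le_floor.2 ?_⟩
    rw [le_div_iff₀ hd']
    have := (le_abs_self _).trans h2
    push_cast at this
    linarith
  have hinj : Set.InjOn (fun x => (x - x₀) / d) (F : Set ℤ) := by
    intro x hx y hy hxy
    obtain ⟨⟨e, he⟩, -⟩ := hF x hx x₀ hx₀
    obtain ⟨⟨e', he'⟩, -⟩ := hF y hy x₀ hx₀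
    simp only [he, he', Int.mul_ediv_cancel_left _ hd.ne'] at hxy
    subst hxy
    linarith
  have hc := Finset.card_le_card_of_injOn _ hmap hinj
  have h0 : 0 ≤ ⌊W / d⌋ := Int.floor_nonneg.2 (by positivity)
  rw [Int.card_Icc] at hc
  have : (F.card : ℤ) ≤ ⌊W / d⌋ + 1 := by omega
  have h3 : (F.card : ℝ) ≤ (⌊W / d⌋ : ℝ) + 1 := by exact_mod_cast this
  linarith [Int.floor_le (W / d)]

/-- Integer triples near the cone `y² = q x` in the direction of a fixed fraction `a / b`. -/
lemma card_near_cone_near_fraction_le {a b : ℤ} (hb : 0 < b) (hab : IsCoprime a b) {h g : ℝ}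
    (hg : 1 ≤ g) (hbh : (b : ℝ) ≤ h) (T : Finset (ℤ × ℤ × ℤ))
    (hT : ∀ v ∈ T, h ^ 2 ≤ (v.1 : ℝ) ∧ (v.1 : ℝ) < 2 * h ^ 2 ∧
      |((v.2.1 * b - v.1 * a : ℤ) : ℝ)| ≤ 2 * h ∧
      |((v.2.1 ^ 2 - v.1 * v.2.2 : ℤ) : ℝ)| ≤ g ^ 2) :
    (T.card : ℝ) ≤ 155 * h * g ^ 2 / b + 6 * g * h ^ 2 / b ^ 2 := by
  have hb' : (1 : ℝ) ≤ b := by exact_mod_cast hb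
  have hh : 1 ≤ h := hb'.trans hbh
  set k : ℤ × ℤ × ℤ → ℤ := fun v => v.1 * a ^ 2 - 2 * v.2.1 * a * b + v.2.2 * b ^ 2 with hk
  set r : ℤ × ℤ × ℤ → ℤ := fun v => v.2.1 * b - v.1 * a with hr
  have key : ∀ v, b ^ 2 * (v.2.1 ^ 2 - v.1 * v.2.2) = r v ^ 2 - v.1 * k v := by
    intro v; simp only [hk, hr]; ring
  have keyR : ∀ v, (b : ℝ) ^ 2 * ((v.2.1 ^ 2 - v.1 * v.2.2 : ℤ) : ℝ)
      = (r v : ℝ) ^ 2 - v.1 * (k v : ℝ) := by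
    intro v; exact_mod_cast key v
  have hrdvd : ∀ v w, k v = k w → b ∣ r v - r w := by
    intro v w hvw
    refine hab.symm.dvd_of_dvd_mul_left (z := r v - r w) (y := a) ?_
    refine ⟨(v.2.2 * b - v.2.1 * a) - (w.2.2 * b - w.2.1 * a), ?_⟩
    simp only [hk, hr] at hvw ⊢
    linarith
  have hqdvd : ∀ v w, k v = k w → r v = r w → b ^ 2 ∣ v.1 - w.1 := by
    intro v w hk' hr'
    have hc : IsCoprime (b ^ 2) (a ^ 2) := (hab.symm).pow
    refine hc.dvd_of_dvd_mul_left (y := a ^ 2) ⟨v.2.2 - w.2.2, ?_⟩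
    simp only [hk, hr] at hk' hr'
    linear_combination (-1) * hk' - 2 * a * hr'
  have hinj : ∀ v w, k v = k w → r v = r w → v.1 = w.1 → v = w := by
    intro v w hk' hr' hq
    simp only [hk, hr, hq] at hk' hr'
    have h1 : v.2.1 = w.2.1 := mul_right_cancel₀ hb.ne' (by linarith)
    rw [h1] at hk'
    have h2 : v.2.2 = w.2.2 := mul_right_cancel₀ (pow_ne_zero 2 hb.ne') (by linarith)
    exact Prod.ext hq (Prod.ext h1 h2)
  -- the number of `q` with prescribed `k` and `r`
  have hqcount : ∀ S ⊆ T, (∀ v ∈ S, ∀ w ∈ S, k v = k w ∧ r v = r w) → ∀ W : ℝ, 0 ≤ W →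
      (∀ v ∈ S, ∀ w ∈ S, |((v.1 - w.1 : ℤ) : ℝ)| ≤ W) → (S.card : ℝ) ≤ W / b ^ 2 + 1 := by
    intro S _ hS W hW hSW
    have h1 : (S.image Prod.fst).card = S.card := Finset.card_image_of_injOn
      fun v hv w hw hvw => hinj v w (hS v hv w hw).1 (hS v hv w hw).2 hvw
    have := card_le_of_dvd_sub_of_abs_sub_le (S.image Prod.fst) (b ^ 2) (by positivity) hW (by
      intro x hx y hy
      obtain ⟨v, hv, rfl⟩ := Finset.mem_image.1 hx
      obtain ⟨w, hw, rfl⟩ := Finset.mem_image.1 hy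
      exact ⟨hqdvd v w (hS v hv w hw).1 (hS v hv w hw).2, hSW v hv w hw⟩)
    rw [h1] at this
    simpa using this
  have hqcount1 : ∀ S ⊆ T, (∀ v ∈ S, ∀ w ∈ S, k v = k w ∧ r v = r w) →
      (S.card : ℝ) ≤ 2 * h ^ 2 / b ^ 2 := by
    intro S hST hS
    have h1 := hqcount S hST hS (h ^ 2) (by positivity) (by
      intro v hv w hw
      have h1 := hT v (hST hv)
      have h2 := hT w (hST hw)
      push_cast
      rw [abs_le]; constructor <;> linarith)
    have h2 : 1 ≤ h ^ 2 / b ^ 2 := by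
      rw [one_le_div (by positivity)]; gcongr
    have h3 : 2 * h ^ 2 / (b : ℝ) ^ 2 = h ^ 2 / b ^ 2 + h ^ 2 / b ^ 2 := by ring
    linarith
  -- the number of `r` with prescribed `k`
  have hrcount : ∀ S ⊆ T, (∀ v ∈ S, ∀ w ∈ S, k v = k w) → ∀ W : ℝ, 0 ≤ W →
      (∀ v ∈ S, |(r v : ℝ)| ≤ W) → ((S.image r).card : ℝ) ≤ 2 * W / b + 1 := by
    intro S _ hS W hW hSW
    refine card_le_of_dvd_sub_of_abs_sub_le (S.image r) b hb (by positivity) ?_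
    intro x hx y hy
    obtain ⟨v, hv, rfl⟩ := Finset.mem_image.1 hx
    obtain ⟨w, hw, rfl⟩ := Finset.mem_image.1 hy
    refine ⟨hrdvd v w (hS v hv w hw), ?_⟩
    have h1 := abs_le.1 (hSW v hv)
    have h2 := abs_le.1 (hSW w hw)
    push_cast
    rw [abs_le]; constructor <;> linarith
  have hsplit := Finset.card_filter_add_card_filter_not (s := T) (fun v => k v = 0)
  have hzero : ((T.filter (fun v => k v = 0)).card : ℝ) ≤ 6 * g * h ^ 2 / b ^ 2 := by
    have hsub : T.filter (fun v => k v = 0) ⊆ T := Finset.filter_subset _ _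
    have h1 := Finset.card_le_mul_of_fiber_le (T.filter (fun v => k v = 0)) r
      (X := 2 * h ^ 2 / b ^ 2) (Y := 3 * g) (by positivity) (by
        intro c
        refine hqcount1 _ ((Finset.filter_subset _ _).trans hsub) ?_
        intro v hv w hw
        simp only [Finset.mem_filter] at hv hw
        exact ⟨by rw [hv.1.2, hw.1.2], by rw [hv.2, hw.2]⟩) (by
        have h2 := hrcount (T.filter (fun v => k v = 0)) hsub (by
          intro v hv w hw
          simp only [Finset.mem_filter] at hv hw
          rw [hv.2, hw.2]) (b * g) (by positivity) (by
          intro v hv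
          simp only [Finset.mem_filter] at hv
          have h3 := keyR v
          rw [hv.2] at h3
          have h4 := (le_abs_self _).trans (hT v hv.1).2.2.2
          refine abs_le_of_sq_le_sq (b := (b : ℝ) * g) ?_ (by positivity)
          have h5 : (b : ℝ) ^ 2 * ((v.2.1 ^ 2 - v.1 * v.2.2 : ℤ) : ℝ) ≤ b ^ 2 * g ^ 2 := by
            gcongr
          rw [h3] at h5
          simp at h5
          linarith)
        have h3 : 2 * (b * g) / (b : ℝ) = 2 * g := by field_simp
        linarith)
    calc _ ≤ _ := h1
      _ = _ := by ring
  have hnonzero : ((T.filter (fun v => ¬ k v = 0)).card : ℝ) ≤ 155 * h * g ^ 2 / b := by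
    set S := T.filter (fun v => ¬ k v = 0) with hSdef
    have hsub : S ⊆ T := Finset.filter_subset _ _
    set m := min (2 * h ^ 2 / (b : ℝ) ^ 2) (3 * g ^ 2) with hm
    have hm0 : 0 ≤ m := by positivity
    have hfib : ∀ c, ((S.filter (fun v => k v = c)).card : ℝ) ≤ (5 * h / b) * m := by
      intro c
      have hsub' : S.filter (fun v => k v = c) ⊆ T := (Finset.filter_subset _ _).trans hsub
      have hkc : ∀ v ∈ S.filter (fun v => k v = c), ∀ w ∈ S.filter (fun v => k v = c),
          k v = k w := by
        intro v hv w hw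
        rw [(Finset.mem_filter.1 hv).2, (Finset.mem_filter.1 hw).2]
      refine Finset.card_le_mul_of_fiber_le _ r hm0 ?_ ?_
      · intro d
        have hsub'' : (S.filter (fun v => k v = c)).filter (fun v => r v = d) ⊆ T :=
          (Finset.filter_subset _ _).trans hsub'
        have hkr : ∀ v ∈ (S.filter (fun v => k v = c)).filter (fun v => r v = d),
            ∀ w ∈ (S.filter (fun v => k v = c)).filter (fun v => r v = d),
            k v = k w ∧ r v = r w := by
          intro v hv w hw
          refine ⟨hkc v (Finset.filter_subset _ _ hv) w (Finset.filter_subset _ _ hw), ?_⟩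
          rw [(Finset.mem_filter.1 hv).2, (Finset.mem_filter.1 hw).2]
        refine le_min (hqcount1 _ hsub'' hkr) ?_
        have h1 := hqcount _ hsub'' hkr (2 * b ^ 2 * g ^ 2) (by positivity) (by
          intro v hv w hw
          have hv0 : k v ≠ 0 :=
            (Finset.mem_filter.1 (Finset.filter_subset _ _ (Finset.filter_subset _ _ hv))).2
          have h1 := keyR v
          have h2 := keyR w
          obtain ⟨h3, h4⟩ := hkr v hv w hw
          rw [← h3, ← h4] at h2
          have h5 := abs_le.1 (hT v (hsub'' hv)).2.2.2
          have h6 := abs_le.1 (hT w (hsub'' hw)).2.2.2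
          have hk1 : (1 : ℝ) ≤ |(k v : ℝ)| := by exact_mod_cast Int.one_le_abs hv0
          have h7 : |((v.1 - w.1 : ℤ) : ℝ)| * |(k v : ℝ)| ≤ 2 * b ^ 2 * g ^ 2 := by
            rw [← abs_mul]
            have h8 : ((v.1 - w.1 : ℤ) : ℝ) * k v = b ^ 2 * (((w.2.1 ^ 2 - w.1 * w.2.2 : ℤ) : ℝ)
                - ((v.2.1 ^ 2 - v.1 * v.2.2 : ℤ) : ℝ)) := by
              rw [mul_sub, h1, h2]; push_cast; ring
            rw [h8, abs_mul, abs_of_nonneg (by positivity : (0 : ℝ) ≤ b ^ 2)]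
            have h9 : |((w.2.1 ^ 2 - w.1 * w.2.2 : ℤ) : ℝ)
                - ((v.2.1 ^ 2 - v.1 * v.2.2 : ℤ) : ℝ)| ≤ 2 * g ^ 2 := by
              rw [abs_le]; constructor <;> linarith
            calc _ ≤ (b : ℝ) ^ 2 * (2 * g ^ 2) := by gcongr
              _ = _ := by ring
          calc |((v.1 - w.1 : ℤ) : ℝ)| = |((v.1 - w.1 : ℤ) : ℝ)| * 1 := by ring
            _ ≤ |((v.1 - w.1 : ℤ) : ℝ)| * |(k v : ℝ)| := by gcongr
            _ ≤ _ := h7)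
        have h2 : 2 * (b : ℝ) ^ 2 * g ^ 2 / b ^ 2 = 2 * g ^ 2 := by field_simp
        nlinarith
      · have h1 := hrcount _ hsub' hkc (2 * h) (by positivity)
          (fun v hv => (hT v (hsub' hv)).2.2.1)
        have h2 : 1 ≤ h / (b : ℝ) := by rw [one_le_div (by positivity)]; exact hbh
        have h3 : 5 * h / (b : ℝ) = 2 * (2 * h) / b + h / b := by ring
        linarith
    have hk : ((S.image k).card : ℝ) ≤ 9 + 2 * (b ^ 2 * g ^ 2 / h ^ 2) := by
      have hkb : ∀ v ∈ S, |(k v : ℝ)| ≤ 4 + b ^ 2 * g ^ 2 / h ^ 2 := by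
        intro v hv
        obtain ⟨h1, h2, h3, h4⟩ := hT v (hsub hv)
        have h5 := keyR v
        have h6 : |(v.1 : ℝ) * (k v : ℝ)| ≤ 4 * h ^ 2 + b ^ 2 * g ^ 2 := by
          have : (v.1 : ℝ) * (k v : ℝ) = (r v : ℝ) ^ 2 - (b : ℝ) ^ 2 *
            ((v.2.1 ^ 2 - v.1 * v.2.2 : ℤ) : ℝ) := by linarith
          rw [this]
          refine (abs_sub _ _).trans ?_
          rw [abs_mul, abs_of_nonneg (by positivity : (0 : ℝ) ≤ b ^ 2), abs_pow]
          have : |(r v : ℝ)| ^ 2 ≤ (2 * h) ^ 2 := by gcongr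
          have : (b : ℝ) ^ 2 * |((v.2.1 ^ 2 - v.1 * v.2.2 : ℤ) : ℝ)| ≤ b ^ 2 * g ^ 2 := by
            gcongr
          linarith
        have h7 : h ^ 2 * |(k v : ℝ)| ≤ 4 * h ^ 2 + b ^ 2 * g ^ 2 := by
          refine le_trans ?_ h6
          rw [abs_mul]
          gcongr
          exact h1.trans (le_abs_self _)
        have h8 : 4 + b ^ 2 * g ^ 2 / h ^ 2 = (4 * h ^ 2 + b ^ 2 * g ^ 2) / h ^ 2 := by
          field_simp
        rw [h8, le_div_iff₀ (by positivity)]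
        linarith
      have h1 := card_le_of_dvd_sub_of_abs_sub_le (S.image k) 1 one_pos
        (W := 2 * (4 + b ^ 2 * g ^ 2 / h ^ 2)) (by positivity) (by
          intro x hx y hy
          obtain ⟨v, hv, rfl⟩ := Finset.mem_image.1 hx
          obtain ⟨w, hw, rfl⟩ := Finset.mem_image.1 hy
          refine ⟨one_dvd _, ?_⟩
          have h1 := abs_le.1 (hkb v hv)
          have h2 := abs_le.1 (hkb w hw)
          push_cast
          rw [abs_le]; constructor <;> linarith)
      simp only [Int.cast_one, div_one] at h1
      linarith
    have h1 := Finset.card_le_mul_of_fiber_le S k (by positivity) hfib hk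
    refine h1.trans ?_
    have h2 : m ≤ 3 * g ^ 2 := min_le_right _ _
    have h3 : (b ^ 2 * g ^ 2 / h ^ 2) * m ≤ 2 * g ^ 2 := by
      calc (b ^ 2 * g ^ 2 / h ^ 2) * m ≤ (b ^ 2 * g ^ 2 / h ^ 2) * (2 * h ^ 2 / (b : ℝ) ^ 2) := by
            gcongr; exact min_le_left _ _
        _ = 2 * g ^ 2 := by field_simp
    have h4 : (9 + 2 * (b ^ 2 * g ^ 2 / h ^ 2)) * m ≤ 31 * g ^ 2 := by linarith
    calc (9 + 2 * (b ^ 2 * g ^ 2 / h ^ 2)) * (5 * h / b * m)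
        = (5 * h / b) * ((9 + 2 * (b ^ 2 * g ^ 2 / h ^ 2)) * m) := by ring
      _ ≤ (5 * h / b) * (31 * g ^ 2) := by gcongr
      _ = _ := by ring
  have : (T.card : ℝ) = ((T.filter (fun v => k v = 0)).card : ℝ)
      + ((T.filter (fun v => ¬ k v = 0)).card : ℝ) := by exact_mod_cast hsplit.symm
  linarith

lemma sum_inv_le_of_sq_le_two_pow {i B : ℕ} (hB : B ^ 2 ≤ 2 ^ i) :
    ∑ b ∈ Finset.Icc 1 B, (1 : ℝ) / b ≤ 1 + i := by
  rcases Nat.eq_zero_or_pos B with rfl | hB0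
  · simp; positivity
  have h1 := harmonic_le_one_add_log B
  rw [harmonic_eq_sum_Icc] at h1
  push_cast at h1
  have h2 : Real.log B ≤ i := by
    have h3 : (B : ℝ) ≤ 2 ^ i := by
      have : B ≤ B ^ 2 := Nat.le_self_pow two_ne_zero B
      exact_mod_cast this.trans hB
    have h4 := Real.log_le_log (by exact_mod_cast hB0) h3
    rw [Real.log_pow] at h4
    have := Real.log_two_lt_d9
    have h5 : (i : ℝ) * Real.log 2 ≤ i * 1 := by gcongr; linarith
    linarith
  simp only [one_div]
  linarith

lemma card_near_cone_le (i : ℕ) {α ℓ g : ℝ} (hℓ : 0 ≤ ℓ) (hℓ1 : ℓ ≤ 1) (hg : 1 ≤ g)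
    (T : Finset (ℤ × ℤ × ℤ))
    (hT : ∀ v ∈ T, (2 : ℝ) ^ i ≤ v.1 ∧ (v.1 : ℝ) < 2 * 2 ^ i ∧
      α - 1 / 2 ^ i ≤ (v.2.1 : ℝ) / v.1 ∧ (v.2.1 : ℝ) / v.1 ≤ α + ℓ + 1 / 2 ^ i ∧
      |((v.2.1 ^ 2 - v.1 * v.2.2 : ℤ) : ℝ)| ≤ g ^ 2) :
    (T.card : ℝ) ≤ 155 * ℓ * 2 ^ i * g ^ 2 +
      900 * (√(2 ^ i) * g ^ 2 + 2 ^ i * g) * (1 + i) := by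
  set N : ℝ := 2 ^ i with hN
  set h := √N with hh
  have hN1 : 1 ≤ N := one_le_pow₀ (by norm_num)
  have hhN : h ^ 2 = N := Real.sq_sqrt (by positivity)
  have hh1 : 1 ≤ h := Real.one_le_sqrt.2 hN1
  set B := ⌊h⌋₊ with hB
  have hB0 : 0 < B := Nat.floor_pos.2 hh1
  have hBh : (B : ℝ) ≤ h := Nat.floor_le (by positivity)
  have hhB : h < B + 1 := Nat.lt_floor_add_one h
  have hBN : B ^ 2 ≤ 2 ^ i := by
    have : (B : ℝ) ^ 2 ≤ 2 ^ i := by rw [← hN, ← hhN]; gcongr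
    exact_mod_cast this
  choose ρ hρ1 hρ2 using fun v : ℤ × ℤ × ℤ =>
    Real.exists_rat_abs_sub_le_and_den_le ((v.2.1 : ℝ) / v.1) hB0
  have hmap : ∀ v ∈ T, (ρ v).den ∈ Finset.Icc 1 B := fun v _ =>
    Finset.mem_Icc.2 ⟨(ρ v).pos, hρ2 v⟩
  have hfib : ∀ b ∈ Finset.Icc 1 B, ((T.filter (fun v => (ρ v).den = b)).card : ℝ) ≤
      (ℓ * b + 5) * (155 * h * g ^ 2 / b + 6 * g * h ^ 2 / b ^ 2) := by
    intro b hb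
    obtain ⟨hb1, hbB⟩ := Finset.mem_Icc.1 hb
    have hb1' : (1 : ℝ) ≤ b := by exact_mod_cast hb1
    have hbB' : (b : ℝ) ≤ B := by exact_mod_cast hbB
    have hbh : (b : ℝ) ≤ h := hbB'.trans hBh
    refine Finset.card_le_mul_of_fiber_le _ (fun v => (ρ v).num) (by positivity) ?_ ?_
    · intro a
      rcases (Finset.filter (fun v => (ρ v).num = a)
        (T.filter (fun v => (ρ v).den = b))).eq_empty_or_nonempty with h0 | ⟨v₀, hv₀⟩
      · rw [h0]; simp; positivity
      simp only [Finset.mem_filter] at hv₀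
      have hcop : IsCoprime a (b : ℤ) := by
        rw [← hv₀.2, ← hv₀.1.2]
        exact Rat.isCoprime_num_den _
      have := card_near_cone_near_fraction_le (b := (b : ℤ)) (by omega) hcop (h := h) hg
        (by simpa using hbh) (Finset.filter (fun v => (ρ v).num = a)
        (T.filter (fun v => (ρ v).den = b))) (by
        intro v hv
        simp only [Finset.mem_filter] at hv
        obtain ⟨⟨hvT, hvb⟩, hva⟩ := hv
        obtain ⟨h1, h2, h3, h4, h5⟩ := hT v hvT
        refine ⟨by rw [hhN]; exact h1, by rw [hhN]; exact h2, ?_, h5⟩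
        have h6 := hρ1 v
        have hq0 : (0 : ℝ) < v.1 := by linarith
        rw [Rat.cast_def, hvb, hva] at h6
        have h7 : ((v.2.1 * b - v.1 * a : ℤ) : ℝ) =
            ((v.2.1 : ℝ) / v.1 - a / b) * (v.1 * b) := by
          push_cast
          field_simp
        rw [h7, abs_mul, abs_of_pos (by positivity : (0 : ℝ) < v.1 * b)]
        calc |(v.2.1 : ℝ) / v.1 - a / b| * (v.1 * b)
            ≤ 1 / ((B + 1) * b) * (2 * N * b) := by gcongr
          _ = 2 * h ^ 2 / (B + 1) := by rw [hhN]; field_simp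
          _ ≤ 2 * h := by
            rw [div_le_iff₀ (by positivity)]
            nlinarith)
      simpa using this
    · have := card_le_of_dvd_sub_of_abs_sub_le ((T.filter (fun v => (ρ v).den = b)).image
        (fun v => (ρ v).num)) 1 one_pos (W := ℓ * b + 4) (by positivity) (by
        have key : ∀ v ∈ T.filter (fun v => (ρ v).den = b),
            α * b - 2 ≤ (ρ v).num ∧ ((ρ v).num : ℝ) ≤ α * b + ℓ * b + 2 := by
          intro v hv
          obtain ⟨hvT, hvb⟩ := Finset.mem_filter.1 hv
          obtain ⟨h1, h2, h3, h4, h5⟩ := hT v hvT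
          have h6 := hρ1 v
          rw [Rat.cast_def, hvb] at h6
          have h7 : 1 / (((B : ℝ) + 1) * b) ≤ 1 / b := by
            gcongr; nlinarith
          have h8 : 1 / N ≤ 1 / (b : ℝ) := by
            gcongr; nlinarith
          have h9 : ((ρ v).num : ℝ) = (ρ v).num / b * b := by field_simp
          have h10 := abs_le.1 (h6.trans h7)
          have h11 : (1 : ℝ) / b * b = 1 := by field_simp
          rw [h9]
          constructor
          · have : α - 1 / (b : ℝ) - 1 / b ≤ (ρ v).num / b := by linarith
            nlinarith
          · have : (ρ v).num / b ≤ α + ℓ + 1 / (b : ℝ) + 1 / b := by linarith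
            nlinarith
        intro x hx y hy
        obtain ⟨v, hv, rfl⟩ := Finset.mem_image.1 hx
        obtain ⟨w, hw, rfl⟩ := Finset.mem_image.1 hy
        have h1 := key v hv
        have h2 := key w hw
        refine ⟨one_dvd _, ?_⟩
        push_cast
        rw [abs_le]; constructor <;> linarith)
      simp only [Int.cast_one, div_one] at this
      linarith
  rw [Finset.card_eq_sum_card_fiberwise hmap]
  push_cast
  have hH := sum_inv_le_of_sq_le_two_pow hBN
  set H := ∑ b ∈ Finset.Icc 1 B, (1 : ℝ) / b with hHdef
  calc ∑ b ∈ Finset.Icc 1 B, ((T.filter (fun v => (ρ v).den = b)).card : ℝ)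
      ≤ ∑ b ∈ Finset.Icc 1 B,
        (155 * ℓ * h * g ^ 2 + (775 * h * g ^ 2 + 36 * g * h ^ 2) * (1 / b)) := by
        refine Finset.sum_le_sum fun b hb => (hfib b hb).trans ?_
        have hb1 : (1 : ℝ) ≤ b := by exact_mod_cast (Finset.mem_Icc.1 hb).1
        have e : (ℓ * b + 5) * (155 * h * g ^ 2 / b + 6 * g * h ^ 2 / (b : ℝ) ^ 2) =
          155 * ℓ * h * g ^ 2 + (775 * h * g ^ 2 + (6 * ℓ) * g * h ^ 2) * (1 / b)
            + 30 * g * h ^ 2 * (1 / b) * (1 / b) := by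
          field_simp; ring
        rw [e]
        have h1 : (1 : ℝ) / b ≤ 1 := by rw [div_le_one (by positivity)]; exact hb1
        have h2 : 30 * g * h ^ 2 * (1 / (b : ℝ)) * (1 / b) ≤ 30 * g * h ^ 2 * (1 / b) * 1 := by
          gcongr
        have h3 : (6 * ℓ) * g * h ^ 2 * (1 / (b : ℝ)) ≤ (6 * 1) * g * h ^ 2 * (1 / b) := by
          gcongr
        nlinarith
    _ = 155 * ℓ * h * g ^ 2 * B + (775 * h * g ^ 2 + 36 * g * h ^ 2) * H := by
        rw [Finset.sum_add_distrib, hHdef, Finset.mul_sum]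
        simp; ring
    _ ≤ 155 * ℓ * h * g ^ 2 * h + (775 * h * g ^ 2 + 36 * g * h ^ 2) * (1 + i) := by
        gcongr
    _ = 155 * ℓ * N * g ^ 2 + (775 * (h * g ^ 2) + 36 * (N * g)) * (1 + i) := by
        rw [← hhN]; ring
    _ ≤ 155 * ℓ * N * g ^ 2 + 900 * (h * g ^ 2 + N * g) * (1 + i) := by
        have : 0 ≤ h * g ^ 2 := by positivity
        have : 0 ≤ N * g := by positivity
        gcongr
        linarith

/-- The points `t` for which some integer point `(q, y, x)` with `2 ^ i ≤ q < 2 ^ (i + 1)` is close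
to the line through `(1, t, t²)`. -/
def dyadicNear (i : ℕ) (ρ ω : ℝ) : Set ℝ :=
  {t | ∃ q y x : ℤ, (2 : ℝ) ^ i ≤ q ∧ (q : ℝ) < 2 * 2 ^ i ∧ |(y : ℝ) - q * t| ≤ ρ ∧
    |(x : ℝ) - 2 * t * y + t ^ 2 * q| ≤ ω}

lemma volume_Icc_inter_dyadicNear_le (i : ℕ) {α ℓ g ρ ω : ℝ} (hℓ : 0 ≤ ℓ) (hℓ1 : ℓ ≤ 1)
    (hg : 1 ≤ g) (hρ : 0 ≤ ρ) (hρ1 : ρ ≤ 1) (hM : ρ ^ 2 + 2 * 2 ^ i * ω ≤ g ^ 2) :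
    volume (Set.Icc α (α + ℓ) ∩ dyadicNear i ρ ω) ≤ ENNReal.ofReal
      (2 * ρ * (155 * ℓ * g ^ 2 + 900 * (g ^ 2 / √(2 ^ i) + g) * (1 + i))) := by
  set N : ℝ := 2 ^ i with hN
  have hN1 : 1 ≤ N := one_le_pow₀ (by norm_num)
  set K := 155 * ℓ * N * g ^ 2 + 900 * (√N * g ^ 2 + N * g) * (1 + i) with hK
  have hK0 : 0 ≤ K := by positivity
  set S : Set (ℤ × ℤ × ℤ) := {v | N ≤ v.1 ∧ (v.1 : ℝ) < 2 * N ∧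
      α - 1 / N ≤ (v.2.1 : ℝ) / v.1 ∧ (v.2.1 : ℝ) / v.1 ≤ α + ℓ + 1 / N ∧
      |((v.2.1 ^ 2 - v.1 * v.2.2 : ℤ) : ℝ)| ≤ g ^ 2} with hS
  have hcard : ∀ T : Finset (ℤ × ℤ × ℤ), (T : Set (ℤ × ℤ × ℤ)) ⊆ S → (T.card : ℝ) ≤ K :=
    fun T hT => card_near_cone_le i hℓ hℓ1 hg T fun v hv => hT hv
  have hfin : S.Finite := by
    by_contra hinf
    obtain ⟨T, hTS, hTc⟩ := Set.Infinite.exists_subset_card_eq hinf (⌊K⌋₊ + 1)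
    have h1 := hcard T hTS
    have h2 := Nat.lt_floor_add_one K
    rw [hTc] at h1
    push_cast at h1
    linarith
  have hTcard := hcard hfin.toFinset (by simp)
  have hcover : Set.Icc α (α + ℓ) ∩ dyadicNear i ρ ω ⊆ ⋃ v ∈ hfin.toFinset,
      Set.Icc ((v.2.1 : ℝ) / v.1 - ρ / N) ((v.2.1 : ℝ) / v.1 + ρ / N) := by
    rintro t ⟨⟨ht1, ht2⟩, q, y, x, h1, h2, h3, h4⟩
    have hq0 : (0 : ℝ) < q := by linarith
    have h5 : |(y : ℝ) / q - t| ≤ ρ / N := by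
      have : (y : ℝ) / q - t = (y - q * t) / q := by field_simp
      rw [this, abs_div, abs_of_pos hq0]
      gcongr
    have h6 := abs_le.1 h5
    have h7 : ρ / N ≤ 1 / N := by gcongr
    simp only [Set.mem_iUnion]
    refine ⟨(q, y, x), ?_, ⟨by linarith, by linarith⟩⟩
    simp only [Set.Finite.mem_toFinset, hS, Set.mem_ofPred_eq]
    refine ⟨h1, h2, by linarith, by linarith, le_trans ?_ hM⟩
    have h8 : ((y ^ 2 - q * x : ℤ) : ℝ) =
        (y - q * t) ^ 2 - q * (x - 2 * t * y + t ^ 2 * q) := by push_cast; ring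
    rw [h8]
    refine (abs_sub _ _).trans ?_
    rw [abs_pow, abs_mul, abs_of_pos hq0]
    gcongr
  calc volume (Set.Icc α (α + ℓ) ∩ dyadicNear i ρ ω)
      ≤ volume (⋃ v ∈ hfin.toFinset,
        Set.Icc ((v.2.1 : ℝ) / v.1 - ρ / N) ((v.2.1 : ℝ) / v.1 + ρ / N)) := measure_mono hcover
    _ ≤ ∑ v ∈ hfin.toFinset,
        volume (Set.Icc ((v.2.1 : ℝ) / v.1 - ρ / N) ((v.2.1 : ℝ) / v.1 + ρ / N)) :=
        measure_biUnion_finset_le _ _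
    _ = hfin.toFinset.card * ENNReal.ofReal (2 * (ρ / N)) := by
        simp only [Real.volume_Icc]
        rw [Finset.sum_congr rfl (g := fun _ => ENNReal.ofReal (2 * (ρ / N)))
          (fun v _ => by congr 1; ring)]
        simp
    _ = ENNReal.ofReal (hfin.toFinset.card * (2 * (ρ / N))) := by
        rw [ENNReal.ofReal_mul (p := (hfin.toFinset.card : ℝ)) (by positivity),
          ENNReal.ofReal_natCast]
    _ ≤ ENNReal.ofReal (K * (2 * (ρ / N))) := by gcongr
    _ = _ := by
        congr 1
        have h1 : √N * √N = N := Real.mul_self_sqrt (by positivity)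
        have h2 : √N / N = 1 / √N := by
          rw [div_eq_div_iff (by positivity) (by positivity)]; linarith
        calc K * (2 * (ρ / N)) = 2 * ρ * (155 * ℓ * g ^ 2 * (N / N)
              + 900 * (g ^ 2 * (√N / N) + g * (N / N)) * (1 + i)) := by rw [hK]; ring
          _ = _ := by rw [h2, div_self (by positivity)]; ring

lemma summable_add_one_pow_mul_geometric (k : ℕ) {r : ℝ} (hr0 : 0 < r) (hr1 : r < 1) :
    Summable fun n : ℕ => ((n : ℝ) + 1) ^ k * r ^ n := by
  have h1 := summable_pow_mul_geometric_of_norm_lt_one k (r := r)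
    (by rwa [Real.norm_of_nonneg hr0.le])
  have h2 := ((summable_nat_add_iff 1).2 h1).mul_left r⁻¹
  refine h2.congr fun n => ?_
  push_cast
  field_simp
  ring

lemma IsApproxFun.summable_sq_iff {φ : ℝ → ℝ} (hφ : IsApproxFun φ) :
    Summable (fun h : ℕ => φ h ^ 2) ↔ Summable fun n : ℕ => 2 ^ n * φ (2 ^ n) ^ 2 := by
  rw [← summable_condensed_iff_of_nonneg (f := fun h : ℕ => φ h ^ 2) (fun n => sq_nonneg _)]
  · push_cast; rfl
  · intro m n hm hmn
    have hm' : (0 : ℝ) < m := by exact_mod_cast hm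
    have hmn' : (m : ℝ) ≤ n := by exact_mod_cast hmn
    have := (hφ.2 n (hm'.trans_le hmn')).le
    have := hφ.1 m n hm' hmn'
    gcongr

lemma distNearestInt_le (x : ℝ) (z : ℤ) : distNearestInt x ≤ |x - z| := round_le x z

lemma one_add_sq_le_four_mul_two_pow (i : ℕ) : (1 + (i : ℝ)) ^ 2 ≤ 4 * 2 ^ i := by
  have h : (1 + i) ^ 2 ≤ 4 * 2 ^ i := by
    induction i with
    | zero => norm_num
    | succ n ih =>
      rcases Nat.lt_or_ge n 2 with hn | hn
      · interval_cases n <;> norm_num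
      · rw [pow_succ 2 n]; nlinarith
  exact_mod_cast h

lemma volume_Icc_inter_dyadicNear_le_of_summable_scale {i : ℕ} {α ρ D : ℝ} (hρ : 0 ≤ ρ)
    (hρi : 2 ^ i * ρ ^ 2 ≤ 1) (hD : 1 ≤ D) :
    volume (Set.Icc α (α + 1) ∩ dyadicNear i ρ (D * ρ)) ≤ ENNReal.ofReal
      (5710 * (3 * D * (2 ^ i * ρ ^ 2) + (1 + i) ^ 2 * (1 / √2) ^ i)) := by
  set N : ℝ := 2 ^ i with hN
  have hN1 : 1 ≤ N := one_le_pow₀ (by norm_num)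
  have hsq : √N = √2 ^ i := by
    rw [hN, Real.sqrt_eq_iff_mul_self_eq (by positivity) (by positivity), ← mul_pow,
      Real.mul_self_sqrt (by norm_num)]
  have hρN : ρ ≤ 1 / √N := by
    rw [le_div_iff₀ (by positivity)]
    refine abs_le_one_iff_mul_self_le_one.2 ?_ |> (le_abs_self _).trans
    have := Real.mul_self_sqrt (by positivity : 0 ≤ N)
    calc ρ * √N * (ρ * √N) = (√N * √N) * ρ ^ 2 := by ring
      _ ≤ 1 := by rwa [this]
  have hs1 : 1 ≤ √N := Real.one_le_sqrt.2 hN1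
  have hρ1 : ρ ≤ 1 := hρN.trans (by rw [div_le_one (by positivity)]; exact hs1)
  set M := 3 * D * (N * ρ) + (1 + (i : ℝ)) ^ 2 with hM
  have hM0 : 0 ≤ M := by positivity
  have hgM : √M ^ 2 = M := Real.sq_sqrt hM0
  have hgi : 1 + (i : ℝ) ≤ √M := Real.le_sqrt_of_sq_le (by rw [hM]; have : 0 ≤ D * (N * ρ) := by positivity
                                                           linarith)
  refine (volume_Icc_inter_dyadicNear_le i (g := √M) zero_le_one le_rfl ?_ hρ hρ1 ?_).trans ?_
  · exact le_trans (by linarith [(Nat.cast_nonneg i : (0 : ℝ) ≤ i)]) hgi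
  · rw [hgM, hM]
    have h1 : ρ ^ 2 ≤ D * (N * ρ) := by
      calc ρ ^ 2 = 1 * (1 * ρ) * ρ := by ring
        _ ≤ D * (N * ρ) * 1 := by gcongr
        _ = _ := by ring
    nlinarith [sq_nonneg (1 + (i : ℝ))]
  · refine ENNReal.ofReal_le_ofReal ?_
    rw [hgM]
    have h1 : (1 + (i : ℝ)) / √N ≤ 2 := by
      rw [div_le_iff₀ (by positivity)]
      refine abs_le_of_sq_le_sq (b := 2 * √N) ?_ (by positivity) |> (le_abs_self _).trans
      rw [mul_pow, Real.sq_sqrt (by positivity)]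
      have := one_add_sq_le_four_mul_two_pow i
      linarith
    have h2 : √M * (1 + (i : ℝ)) ≤ M := by
      calc √M * (1 + (i : ℝ)) ≤ √M * √M := by gcongr
        _ = M := Real.mul_self_sqrt hM0
    calc 2 * ρ * (155 * 1 * M + 900 * (M / √N + √M) * (1 + i))
        = 2 * ρ * (155 * M + 900 * (M * ((1 + i) / √N) + √M * (1 + i))) := by ring
      _ ≤ 2 * ρ * (155 * M + 900 * (M * 2 + M)) := by gcongr
      _ = 5710 * (3 * D * (N * ρ ^ 2) + (1 + i) ^ 2 * ρ) := by rw [hM]; ring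
      _ ≤ _ := by
        have : (1 / √2) ^ i = 1 / √N := by rw [hsq, div_pow, one_pow]
        rw [this]
        gcongr

lemma abs_sub_two_mul_add_le {t y x q e : ℝ} (hy : |y - q * t| ≤ e) (hx : |x - q * t ^ 2| ≤ e) :
    |x - 2 * t * y + t ^ 2 * q| ≤ (1 + 2 * |t|) * e := by
  have h : x - 2 * t * y + t ^ 2 * q = (x - q * t ^ 2) - 2 * t * (y - q * t) := by ring
  rw [h]
  refine (abs_sub _ _).trans ?_
  rw [abs_mul, abs_mul, abs_two]
  have : 2 * |t| * |y - q * t| ≤ 2 * |t| * e := by gcongr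
  linarith

lemma ae_notMem_simApprox2_of_summable {φ : ℝ → ℝ} (hφ : IsApproxFun φ)
    (hs : Summable fun h : ℕ => φ h ^ 2) : ∀ᵐ t : ℝ, (t, t ^ 2) ∉ SimApprox2 φ := by
  have hc := hφ.summable_sq_iff.1 hs
  obtain ⟨n₀, hn₀⟩ : ∃ n₀ : ℕ, ∀ n ≥ n₀, 2 ^ n * φ (2 ^ n) ^ 2 ≤ 1 :=
    eventually_atTop.1 (hc.tendsto_atTop_zero.eventually_le_const one_pos)
  have hcell : ∀ a : ℤ, volume {t : ℝ | ∃ᶠ n : ℕ in atTop, t ∈ Set.Icc (a : ℝ) (a + 1) ∩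
      dyadicNear (n + n₀) (φ (2 ^ (n + n₀))) ((1 + 2 * (|(a : ℝ)| + 1)) * φ (2 ^ (n + n₀)))} = 0 := by
    intro a
    refine measure_setOfPred_frequently_eq_zero ?_
    have hsum : Summable fun i : ℕ => 5710 * (3 * (1 + 2 * (|(a : ℝ)| + 1)) * (2 ^ i * φ (2 ^ i) ^ 2)
        + (1 + (i : ℝ)) ^ 2 * (1 / √2) ^ i) := by
      refine ((hc.mul_left _).add ?_).mul_left _
      have := summable_add_one_pow_mul_geometric 2 (r := 1 / √2) (by positivity)
        (by rw [div_lt_one (by positivity)]; exact Real.lt_sqrt_of_sq_lt (by norm_num))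
      exact this.congr fun n => by ring
    have hsum' := ((summable_nat_add_iff n₀).2 hsum).tsum_ofReal_ne_top
    refine ne_top_of_le_ne_top hsum' (ENNReal.tsum_le_tsum fun n => ?_)
    exact volume_Icc_inter_dyadicNear_le_of_summable_scale (hφ.2 _ (by positivity)).le
      (hn₀ _ (by omega)) (by linarith [abs_nonneg (a : ℝ)])
  have hall := (ae_all_iff (μ := volume)).2 fun a : ℤ => compl_mem_ae_iff.2 (hcell a)
  filter_upwards [hall] with t ht hmem
  refine ht ⌊t⌋ (frequently_atTop.2 fun n => ?_)
  obtain ⟨q, ⟨hq0, hq⟩, hqn⟩ := Set.Infinite.exists_gt hmem (2 ^ (n + n₀))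
  set i := Nat.log 2 q
  have hi1 : 2 ^ i ≤ q := Nat.pow_log_le_self 2 hq0.ne'
  have hi2 : q < 2 ^ (i + 1) := Nat.lt_pow_succ_log_self one_lt_two q
  have hi3 : n + n₀ < i + 1 := (Nat.pow_lt_pow_iff_right one_lt_two).1 (hqn.trans hi2)
  have hi1' : (2 : ℝ) ^ i ≤ q := by exact_mod_cast hi1
  refine ⟨i - n₀, by omega, ⟨Int.floor_le t, (Int.lt_floor_add_one t).le⟩, ?_⟩
  rw [show i - n₀ + n₀ = i by omega]
  have hmono : φ q ≤ φ (2 ^ i) := hφ.1 _ _ (by positivity) hi1'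
  have hpos : 0 < φ (2 ^ i) := hφ.2 _ (by positivity)
  simp only [distNearestInt, max_lt_iff] at hq
  have hy : |((round ((q : ℝ) * t) : ℤ) : ℝ) - q * t| ≤ φ (2 ^ i) := by
    rw [abs_sub_comm]; exact (hq.1.trans_le hmono).le
  have hx : |((round ((q : ℝ) * t ^ 2) : ℤ) : ℝ) - q * t ^ 2| ≤ φ (2 ^ i) := by
    rw [abs_sub_comm]; exact (hq.2.trans_le hmono).le
  refine ⟨q, round ((q : ℝ) * t), round ((q : ℝ) * t ^ 2), by exact_mod_cast hi1,
    by rw [pow_succ'] at hi2; exact_mod_cast hi2, by exact_mod_cast hy, ?_⟩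
  have h1 := abs_sub_two_mul_add_le hy hx
  have h2 : |t| ≤ |((⌊t⌋ : ℤ) : ℝ)| + 1 := by
    have h3 : |t - ⌊t⌋| ≤ 1 := by
      rw [abs_le]; constructor <;> linarith [Int.floor_le t, Int.lt_floor_add_one t]
    calc |t| = |(⌊t⌋ : ℝ) + (t - ⌊t⌋)| := by ring_nf
      _ ≤ _ := (abs_add_le _ _).trans (by linarith)
  have h3 : (1 + 2 * |t|) * φ (2 ^ i) ≤ (1 + 2 * (|((⌊t⌋ : ℤ) : ℝ)| + 1)) * φ (2 ^ i) := by gcongr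
  exact_mod_cast h1.trans h3

lemma abs_fract_sub_fract_le {u v : ℝ} {R : ℕ} (hR : 0 < R)
    (h : ⌊Int.fract u * R⌋ = ⌊Int.fract v * R⌋) : |Int.fract u - Int.fract v| ≤ (1 : ℝ) / R := by
  have hR' : (0 : ℝ) < R := by exact_mod_cast hR
  have h1 := Int.abs_sub_lt_one_of_floor_eq_floor h
  rw [← sub_mul, abs_mul, abs_of_pos hR'] at h1
  rw [le_div_iff₀ hR']
  exact h1.le

/-- A Dirichlet-type theorem along the parabola. -/
lemma exists_int_near_parabola_line (t : ℝ) {R S N : ℕ} (hR : 0 < R) (hS : 0 < S)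
    (hRS : R * S ≤ N) : ∃ q y x : ℤ, 0 < q ∧ q ≤ N ∧ |(y : ℝ) - q * t| ≤ (1 : ℝ) / R ∧
      |(x : ℝ) - 2 * t * y + t ^ 2 * q| ≤ (1 : ℝ) / S := by
  set W : ℕ → ℝ := fun q => t ^ 2 * q - 2 * t * ⌊(q : ℝ) * t⌋ with hW
  have hmem : ∀ (u : ℝ) {R : ℕ}, 0 < R → ⌊Int.fract u * R⌋ ∈ Finset.Ico (0 : ℤ) R := by
    intro u R hR
    have hR' : (0 : ℝ) < R := by exact_mod_cast hR
    rw [Finset.mem_Ico]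
    refine ⟨Int.floor_nonneg.2 (mul_nonneg (Int.fract_nonneg _) hR'.le), Int.floor_lt.2 ?_⟩
    have := Int.fract_lt_one u
    push_cast
    nlinarith
  obtain ⟨q₁, hq₁, q₂, hq₂, hne, heq⟩ := Finset.exists_ne_map_eq_of_card_lt_of_maps_to
    (s := Finset.range (N + 1)) (t := Finset.Ico (0 : ℤ) R ×ˢ Finset.Ico (0 : ℤ) S)
    (by simp; omega)
    (f := fun q => (⌊Int.fract ((q : ℝ) * t) * R⌋, ⌊Int.fract (W q) * S⌋))
    (fun q _ => Finset.mem_product.2 ⟨hmem _ hR, hmem _ hS⟩)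
  wlog hlt : q₁ < q₂ generalizing q₁ q₂
  · exact this q₂ hq₂ q₁ hq₁ hne.symm heq.symm (by omega)
  rw [Finset.mem_range] at hq₁ hq₂
  obtain ⟨h1, h2⟩ := Prod.ext_iff.1 heq
  have h1' := abs_fract_sub_fract_le hR h1
  have h2' := abs_fract_sub_fract_le hS h2
  refine ⟨q₂ - q₁, ⌊(q₂ : ℝ) * t⌋ - ⌊(q₁ : ℝ) * t⌋, ⌊W q₁⌋ - ⌊W q₂⌋, by omega, by omega, ?_, ?_⟩
  · convert h1' using 2
    simp only [Int.fract]
    push_cast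
    ring
  · rw [abs_sub_comm] at h2'
    convert h2' using 2
    simp only [Int.fract, hW]
    push_cast
    ring

/-- The points `t` for which some integer point `(q, y, x)` with `2 ^ (n - κ) ≤ q ≤ 2 ^ n` is
within `3 δ` of the line through `(1, t, t²)`. -/
def scaleHit (κ n : ℕ) (δ : ℝ) : Set ℝ :=
  {t | ∃ q y x : ℤ, (2 : ℝ) ^ (n - κ) ≤ q ∧ (q : ℝ) ≤ 2 ^ n ∧ |(y : ℝ) - q * t| ≤ δ ∧
    |(x : ℝ) - 2 * t * y + t ^ 2 * q| ≤ 3 * δ}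

lemma exists_center_of_notMem_dyadicNear {κ n : ℕ} {δ t : ℝ} (hκ : κ ≤ n) (hδ : 0 < δ)
    (hδ1 : δ ≤ 1) (hμ : 16 * 2 ^ κ ≤ 2 ^ n * δ)
    (ht : ∀ i < n - κ, t ∉ dyadicNear i (4 / (2 ^ n * δ)) δ) :
    ∃ s, |s - t| ≤ 4 * 2 ^ κ / (2 ^ n * δ * 2 ^ n) ∧
      ∀ t', |t' - s| ≤ δ / 2 ^ n → t' ∈ scaleHit κ n δ := by
  set μ : ℝ := 2 ^ n * δ with hμdef
  have hκ1 : (1 : ℝ) ≤ 2 ^ κ := one_le_pow₀ (by norm_num)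
  have hn1 : (1 : ℝ) ≤ 2 ^ n := one_le_pow₀ (by norm_num)
  have hμ16 : 16 ≤ μ := by linarith
  set S := ⌈1 / δ⌉₊ with hS
  have hS0 : 0 < S := Nat.ceil_pos.2 (by positivity)
  have hS1 : 1 / δ ≤ S := Nat.le_ceil _
  have hS2 : (S : ℝ) ≤ 2 / δ := by
    have h1 := (Nat.ceil_lt_add_one (by positivity : 0 ≤ 1 / δ)).le
    have h2 : 1 ≤ 1 / δ := by rw [one_le_div hδ]; exact hδ1
    have h3 : 2 / δ = 1 / δ + 1 / δ := by ring
    linarith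
  have hS0' : (0 : ℝ) < S := by exact_mod_cast hS0
  set R := 2 ^ n / S with hR
  have hR1 : μ / 4 ≤ R := by
    have h1 : 2 ^ n < S * (R + 1) := Nat.lt_mul_div_succ _ hS0
    have h1' : (2 : ℝ) ^ n < S * (R + 1) := by exact_mod_cast h1
    have h2 : (S : ℝ) * (R + 1) ≤ 2 / δ * (R + 1) := by gcongr
    have h3 : μ < 2 * (R + 1) := by
      have h4 : (2 : ℝ) ^ n < 2 * (R + 1) / δ := by
        calc _ < _ := h1'
          _ ≤ _ := h2
          _ = _ := by ring
      rw [lt_div_iff₀ hδ] at h4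
      exact h4
    linarith
  have hR0' : (0 : ℝ) < R := by linarith
  have hR0 : 0 < R := by exact_mod_cast hR0'
  obtain ⟨q, y, x, hq0, hqN, hy, hx⟩ := exists_int_near_parabola_line t hR0 hS0
    (N := 2 ^ n) (Nat.div_mul_le_self _ _)
  have hq0' : (0 : ℝ) < q := by exact_mod_cast hq0
  have hqN' : (q : ℝ) ≤ 2 ^ n := by exact_mod_cast hqN
  have hy' : |(y : ℝ) - q * t| ≤ 4 / μ := by
    refine hy.trans ?_
    rw [div_le_div_iff₀ hR0' (by positivity)]
    linarith
  have hx' : |(x : ℝ) - 2 * t * y + t ^ 2 * q| ≤ δ := by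
    refine hx.trans ?_
    rw [div_le_iff₀ hS0']
    rw [div_le_iff₀ hδ] at hS1
    linarith
  have hqκ : (2 : ℝ) ^ (n - κ) ≤ q := by
    by_contra! hlt
    lift q to ℕ using hq0.le
    have hq0'' : q ≠ 0 := by rintro rfl; simp at hq0
    have hlt' : q < 2 ^ (n - κ) := by exact_mod_cast hlt
    have hi1 : 2 ^ Nat.log 2 q ≤ q := Nat.pow_log_le_self 2 hq0''
    have hi2 : q < 2 ^ (Nat.log 2 q + 1) := Nat.lt_pow_succ_log_self one_lt_two q
    refine ht (Nat.log 2 q) ((Nat.pow_lt_pow_iff_right one_lt_two).1 (hi1.trans_lt hlt'))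
      ⟨q, y, x, by exact_mod_cast hi1, ?_, hy', hx'⟩
    rw [pow_succ'] at hi2
    exact_mod_cast hi2
  have hpow : (2 : ℝ) ^ n = 2 ^ (n - κ) * 2 ^ κ := by rw [← pow_add]; congr 1; omega
  have hqκ' : (2 : ℝ) ^ n ≤ q * 2 ^ κ := by rw [hpow]; gcongr
  have hst : |(y : ℝ) / q - t| ≤ 4 / (μ * q) := by
    have h1 : (y : ℝ) / q - t = (y - q * t) / q := by field_simp
    rw [h1, abs_div, abs_of_pos hq0', ← div_div]
    gcongr
  refine ⟨y / q, hst.trans ?_, fun t' ht' => ⟨q, y, x, hqκ, hqN', ?_, ?_⟩⟩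
  · rw [div_le_div_iff₀ (by positivity) (by positivity)]
    have : 4 * (μ * 2 ^ n) ≤ 4 * (μ * (q * 2 ^ κ)) := by gcongr
    linarith
  · have h1 : (y : ℝ) - q * t' = q * (-(t' - y / q)) := by field_simp; ring
    rw [h1, abs_mul, abs_neg, abs_of_pos hq0']
    calc q * |t' - y / q| ≤ 2 ^ n * (δ / 2 ^ n) := by gcongr
      _ = δ := by field_simp
  · have h1 : (x : ℝ) - 2 * t' * y + t' ^ 2 * q = (x - 2 * t * y + t ^ 2 * q)
        - q * (y / q - t) ^ 2 + q * (t' - y / q) ^ 2 := by field_simp; ring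
    have h2 : |(q : ℝ) * (y / q - t) ^ 2| ≤ δ := by
      rw [abs_mul, abs_of_pos hq0', abs_pow]
      calc (q : ℝ) * |(y : ℝ) / q - t| ^ 2 ≤ q * (4 / (μ * q)) ^ 2 := by gcongr
        _ = 16 / (μ ^ 2 * q) := by field_simp; norm_num
        _ ≤ δ := by
          rw [div_le_iff₀ (by positivity)]
          have h3 : μ ≤ δ * q * 2 ^ κ := by
            calc μ = δ * 2 ^ n := by rw [hμdef]; ring
              _ ≤ δ * (q * 2 ^ κ) := by gcongr
              _ = _ := by ring
          have h4 : 16 * 2 ^ κ ≤ δ * q * 2 ^ κ := hμ.trans h3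
          have h5 : 16 ≤ δ * q := le_of_mul_le_mul_right h4 (by positivity)
          have h6 : 1 ≤ μ ^ 2 := one_le_pow₀ (by linarith)
          calc (16 : ℝ) = 1 * 16 := by ring
            _ ≤ μ ^ 2 * (δ * q) := by gcongr
            _ = _ := by ring
    have h3 : |(q : ℝ) * (t' - y / q) ^ 2| ≤ δ := by
      rw [abs_mul, abs_of_pos hq0', abs_pow]
      calc (q : ℝ) * |t' - y / q| ^ 2 ≤ 2 ^ n * (δ / 2 ^ n) ^ 2 := by gcongr
        _ = δ * (δ / 2 ^ n) := by field_simp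
        _ ≤ δ * 1 := by
          gcongr
          rw [div_le_one (by positivity)]
          linarith
        _ = δ := mul_one _
    rw [h1]
    have h4 := abs_le.1 h2
    have h5 := abs_le.1 h3
    have h6 := abs_le.1 hx'
    rw [abs_le]; constructor <;> linarith

lemma volume_Icc_inter_iUnion_dyadicNear_le {n : ℕ} {δ α ℓ : ℝ} (hn : 14 ≤ n) (hδ : 0 < δ)
    (hδn : 2 ^ n * δ ^ 2 ≤ 1) (hμ : ((n : ℝ) + 1) ^ 6 ≤ 2 ^ n * δ) (hℓ : 0 < ℓ) (hℓ1 : ℓ ≤ 1)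
    (hnℓ : 150000 ≤ ℓ * (n + 1)) :
    volume (Set.Icc α (α + ℓ) ∩ ⋃ i ∈ Finset.range (n - 14),
      dyadicNear i (4 / (2 ^ n * δ)) δ) ≤ ENNReal.ofReal (ℓ / 2) := by
  set μ : ℝ := 2 ^ n * δ with hμdef
  have hn1 : (15 : ℝ) ≤ (n : ℝ) + 1 := by
    have : (14 : ℝ) ≤ n := by exact_mod_cast hn
    linarith
  have hμ1 : ((n : ℝ) + 1) ^ 3 ≤ √μ := by
    refine Real.le_sqrt_of_sq_le ?_
    rw [← pow_mul]
    exact hμ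
  have hn2 : ((n : ℝ) + 1) ^ 2 ≤ ((n : ℝ) + 1) ^ 3 := pow_le_pow_right₀ (by linarith) (by norm_num)
  have hs15 : 225 ≤ √μ := by nlinarith
  have hμ0 : 0 < μ := by positivity
  have hμs : √μ * √μ = μ := Real.mul_self_sqrt hμ0.le
  have hμ4 : 4 ≤ μ := by nlinarith
  have hterm : ∀ i ∈ Finset.range (n - 14),
      volume (Set.Icc α (α + ℓ) ∩ dyadicNear i (4 / μ) δ) ≤ ENNReal.ofReal
        (8 / μ * (155 * ℓ * (1 + 2 * δ * 2 ^ i) + 4500 * √μ * (n + 1))) := by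
    intro i hi
    have hin : i ≤ n := by have := Finset.mem_range.1 hi; omega
    have hin' : (i : ℝ) ≤ n := by exact_mod_cast hin
    have hpow : (2 : ℝ) ^ i ≤ 2 ^ n := pow_le_pow_right₀ (by norm_num) hin
    have hi1 : (1 : ℝ) ≤ 2 ^ i := one_le_pow₀ (by norm_num)
    have hM1 : (1 : ℝ) ≤ 1 + 2 * δ * 2 ^ i := by linarith [show 0 ≤ 2 * δ * 2 ^ i by positivity]
    have h4μ : 4 / μ ≤ 1 := by rw [div_le_one hμ0]; exact hμ4
    have hsq := Real.sq_sqrt (by linarith : (0 : ℝ) ≤ 1 + 2 * δ * 2 ^ i)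
    have hd : δ * √(2 ^ i) ≤ 1 := by
      refine abs_le_one_iff_mul_self_le_one.2 ?_ |> (le_abs_self _).trans
      calc δ * √(2 ^ i) * (δ * √(2 ^ i)) = (√(2 ^ i) * √(2 ^ i)) * δ ^ 2 := by ring
        _ = 2 ^ i * δ ^ 2 := by rw [Real.mul_self_sqrt (by positivity)]
        _ ≤ 2 ^ n * δ ^ 2 := by gcongr
        _ ≤ 1 := hδn
    refine (volume_Icc_inter_dyadicNear_le i (g := √(1 + 2 * δ * 2 ^ i)) hℓ.le hℓ1
      (Real.one_le_sqrt.2 hM1) (by positivity) h4μ ?_).trans (ENNReal.ofReal_le_ofReal ?_)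
    · rw [hsq]
      have : (4 / μ) ^ 2 ≤ 1 := pow_le_one₀ (by positivity) h4μ
      linarith
    · rw [hsq]
      have h1 : (1 + 2 * δ * 2 ^ i) / √(2 ^ i) ≤ 3 * √μ := by
        rw [div_le_iff₀ (by positivity)]
        have h2 : √(2 ^ i) * √(2 ^ i) = (2 : ℝ) ^ i := Real.mul_self_sqrt (by positivity)
        have h3 : 1 ≤ √((2 : ℝ) ^ i) := Real.one_le_sqrt.2 hi1
        calc 1 + 2 * δ * 2 ^ i = 1 + 2 * (δ * √(2 ^ i)) * √(2 ^ i) := by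
              linear_combination (-2 * δ) * h2
          _ ≤ √(2 ^ i) + 2 * 1 * √(2 ^ i) := by gcongr
          _ = 3 * 1 * √(2 ^ i) := by ring
          _ ≤ 3 * √μ * √(2 ^ i) := by gcongr; linarith
      have h2 : √(1 + 2 * δ * 2 ^ i) ≤ 2 * √μ := by
        refine Real.sqrt_le_iff.2 ⟨by positivity, ?_⟩
        have : δ * 2 ^ i ≤ μ := by rw [hμdef, mul_comm]; gcongr
        rw [mul_pow, sq √μ, hμs]
        linarith
      calc 2 * (4 / μ) * (155 * ℓ * (1 + 2 * δ * 2 ^ i) +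
            900 * ((1 + 2 * δ * 2 ^ i) / √(2 ^ i) + √(1 + 2 * δ * 2 ^ i)) * (1 + i))
          ≤ 2 * (4 / μ) * (155 * ℓ * (1 + 2 * δ * 2 ^ i) +
            900 * (3 * √μ + 2 * √μ) * (1 + n)) := by gcongr
        _ = _ := by ring
  rw [Set.inter_iUnion₂]
  refine (measure_biUnion_finset_le _ _).trans ((Finset.sum_le_sum hterm).trans ?_)
  rw [← ENNReal.ofReal_sum_of_nonneg (fun i _ => by positivity)]
  refine ENNReal.ofReal_le_ofReal ?_
  have hgeom : ∑ i ∈ Finset.range (n - 14), (2 : ℝ) ^ i ≤ 2 ^ n / 16384 := by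
    rw [geom_sum_eq (by norm_num)]
    have : (2 : ℝ) ^ n = 2 ^ (n - 14) * 2 ^ 14 := by rw [← pow_add]; congr 1; omega
    rw [this]
    norm_num
  have hcast : ((n - 14 : ℕ) : ℝ) ≤ n + 1 := by
    have : ((n - 14 : ℕ) : ℝ) ≤ n := by exact_mod_cast Nat.sub_le _ _
    linarith
  calc ∑ i ∈ Finset.range (n - 14),
        8 / μ * (155 * ℓ * (1 + 2 * δ * 2 ^ i) + 4500 * √μ * (n + 1))
      = 8 / μ * ((155 * ℓ + 4500 * √μ * (n + 1)) * ((n - 14 : ℕ) : ℝ)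
        + 310 * ℓ * δ * ∑ i ∈ Finset.range (n - 14), (2 : ℝ) ^ i) := by
        rw [← Finset.mul_sum]
        congr 1
        have hc : ((n - 14 : ℕ) : ℝ) = ∑ _i ∈ Finset.range (n - 14), (1 : ℝ) := by simp
        rw [hc, Finset.mul_sum, Finset.mul_sum, ← Finset.sum_add_distrib]
        exact Finset.sum_congr rfl fun i _ => by ring
    _ ≤ 8 / μ * ((155 * 1 + 4500 * √μ * (n + 1)) * (n + 1)
        + 310 * ℓ * δ * (2 ^ n / 16384)) := by gcongr
    _ = (1240 * (n + 1)) / μ + 36000 * (n + 1) ^ 2 * (√μ / μ)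
        + 2480 / 16384 * ℓ * ((2 ^ n * δ) / μ) := by ring
    _ ≤ 1240 / (n + 1) + 36000 / (n + 1) + 2480 / 16384 * ℓ * 1 := by
        have h1 : (1240 * ((n : ℝ) + 1)) / μ ≤ 1240 / (n + 1) := by
          rw [div_le_div_iff₀ hμ0 (by positivity)]
          nlinarith
        have h2 : 36000 * ((n : ℝ) + 1) ^ 2 * (√μ / μ) ≤ 36000 / (n + 1) := by
          have h3 : √μ / μ = 1 / √μ := by
            rw [div_eq_div_iff (by positivity) (by positivity)]; linarith
          rw [h3, mul_one_div, div_le_div_iff₀ (by positivity) (by positivity)]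
          linarith
        rw [← hμdef, div_self hμ0.ne']
        gcongr
    _ ≤ ℓ / 2 := by
        have h1 : 1240 / ((n : ℝ) + 1) + 36000 / (n + 1) ≤ ℓ * (37240 / 150000) := by
          rw [← add_div, div_le_iff₀ (by positivity)]
          linarith
        linarith

lemma card_le_floor_add_one_of_separated {P : Finset ℝ} {α ℓ σ : ℝ} (hσ : 0 < σ)
    (hP : (P : Set ℝ) ⊆ Set.Icc α (α + ℓ)) (hs : ∀ p ∈ P, ∀ p' ∈ P, p ≠ p' → σ < |p - p'|) :
    (P.card : ℝ) ≤ ⌊ℓ / σ⌋₊ + 1 := by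
  have hcard : P.card ≤ (Finset.range (⌊ℓ / σ⌋₊ + 1)).card := by
    refine Finset.card_le_card_of_injOn (fun p => ⌊(p - α) / σ⌋₊) (fun p hp => ?_)
      fun p hp p' hp' h => ?_
    · have := hP hp
      rw [Finset.coe_range, Set.mem_Iio, Nat.lt_succ_iff]
      refine Nat.floor_le_floor ?_
      gcongr
      linarith [this.2]
    · by_contra hne
      have h1 := hs p hp p' hp' hne
      have h2 : |(p - α) / σ - (p' - α) / σ| < 1 := by
        have ha : 0 ≤ (p - α) / σ := div_nonneg (by linarith [(hP hp).1]) hσ.le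
        have hb : 0 ≤ (p' - α) / σ := div_nonneg (by linarith [(hP hp').1]) hσ.le
        have h3 := Nat.floor_le ha
        have h4 := Nat.lt_floor_add_one ((p - α) / σ)
        have h5 := Nat.floor_le hb
        have h6 := Nat.lt_floor_add_one ((p' - α) / σ)
        simp only at h
        rw [h] at h3 h4
        rw [abs_lt]; constructor <;> linarith
      rw [← sub_div, abs_div, abs_of_pos hσ, div_lt_one hσ] at h2
      rw [show p - α - (p' - α) = p - p' by ring] at h2
      linarith
  rw [Finset.card_range] at hcard
  exact_mod_cast hcard

lemma exists_separated_finset {A : Set ℝ} {α ℓ σ : ℝ} (hσ : 0 < σ) (hℓ : 0 ≤ ℓ)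
    (hA : A ⊆ Set.Icc α (α + ℓ)) : ∃ P : Finset ℝ, (P : Set ℝ) ⊆ A ∧
      (∀ p ∈ P, ∀ p' ∈ P, p ≠ p' → σ < |p - p'|) ∧ (P.card : ℝ) ≤ ℓ / σ + 1 ∧
      volume A ≤ ENNReal.ofReal (P.card * (2 * σ)) := by
  classical
  have hb : ∀ P : Finset ℝ, (P : Set ℝ) ⊆ A → (∀ p ∈ P, ∀ p' ∈ P, p ≠ p' → σ < |p - p'|) →
      P.card ≤ ⌊ℓ / σ⌋₊ + 1 := fun P h1 h2 => by
    exact_mod_cast card_le_floor_add_one_of_separated hσ (h1.trans hA) h2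
  let p : ℕ → Prop := fun k => ∃ P : Finset ℝ, (P : Set ℝ) ⊆ A ∧
    (∀ p ∈ P, ∀ p' ∈ P, p ≠ p' → σ < |p - p'|) ∧ P.card = k
  obtain ⟨P, hPA, hPs, hPc⟩ : p (Nat.findGreatest p (⌊ℓ / σ⌋₊ + 1)) :=
    Nat.findGreatest_spec (Nat.zero_le _) ⟨∅, by simp⟩
  refine ⟨P, hPA, hPs, ?_, ?_⟩
  · have h1 : (P.card : ℝ) ≤ ⌊ℓ / σ⌋₊ + 1 := by exact_mod_cast hb P hPA hPs
    linarith [Nat.floor_le (by positivity : 0 ≤ ℓ / σ)]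
  · have hsub : A ⊆ ⋃ q ∈ P, Metric.closedBall q σ := by
      intro t ht
      by_contra hcon
      simp only [Set.mem_iUnion, Metric.mem_closedBall, Real.dist_eq, not_exists, not_le] at hcon
      have htP : t ∉ P := fun h => by simpa using (hcon t h).trans' hσ
      have hlt : Nat.findGreatest p (⌊ℓ / σ⌋₊ + 1) < (insert t P).card := by
        rw [Finset.card_insert_of_notMem htP, hPc]; omega
      have h1 : ((insert t P : Finset ℝ) : Set ℝ) ⊆ A := by
        rw [Finset.coe_insert]; exact Set.insert_subset ht hPA
      have h2 : ∀ p ∈ insert t P, ∀ p' ∈ insert t P, p ≠ p' → σ < |p - p'| := by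
        intro a ha b hb' hab
        rw [Finset.mem_insert] at ha hb'
        rcases ha with rfl | ha <;> rcases hb' with rfl | hb'
        · exact absurd rfl hab
        · exact hcon b hb'
        · rw [abs_sub_comm]; exact hcon a ha
        · exact hPs a ha b hb' hab
      exact Nat.findGreatest_is_greatest hlt (hb _ h1 h2) ⟨_, h1, h2, rfl⟩
    refine (measure_mono hsub).trans ((measure_biUnion_finset_le _ _).trans ?_)
    simp only [Real.volume_closedBall, Finset.sum_const, nsmul_eq_mul]
    rw [ENNReal.ofReal_mul (Nat.cast_nonneg _), ENNReal.ofReal_natCast]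

/-- A set of small measure which contains a ball of radius `r` within distance `ρ` of every point
outside of a set `B` still leaves room for many new balls contained in it. -/
lemma exists_extension_by_balls {V U B : Set ℝ} {α ℓ ρ r v N : ℝ} (hr : 0 < r) (hrρ : r ≤ ρ)
    (hρℓ : 100 * ρ ≤ ℓ) (hB : volume (Set.Icc α (α + ℓ) ∩ B) ≤ ENNReal.ofReal (ℓ / 2))
    (hc : ∀ t ∉ B, ∃ s, |s - t| ≤ ρ ∧ Metric.closedBall s r ⊆ V)
    (hU : MeasurableSet U) (hUV : U ⊆ V ∩ Set.Icc (α - ℓ) (α + 2 * ℓ)) (hv0 : 0 ≤ v)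
    (hUv : volume U = ENNReal.ofReal v) (hN0 : 0 ≤ N)
    (hth : ∀ τ : ℝ, 0 ≤ τ → volume {t | ∃ u ∈ U, |u - t| ≤ τ} ≤ ENNReal.ofReal (v + 2 * τ * N))
    (hv : v ≤ ℓ / 10) (hN : N * ρ ≤ 2 * ℓ / 100) :
    ∃ (U' : Set ℝ) (v' N' : ℝ), MeasurableSet U' ∧ U' ⊆ V ∩ Set.Icc (α - ℓ) (α + 2 * ℓ) ∧
      0 ≤ v' ∧ volume U' = ENNReal.ofReal v' ∧ 0 ≤ N' ∧
      (∀ τ : ℝ, 0 ≤ τ → volume {t | ∃ u ∈ U', |u - t| ≤ τ} ≤ ENNReal.ofReal (v' + 2 * τ * N')) ∧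
      N' ≤ N + 2 * ℓ / 100 * (1 / ρ) ∧ v + ℓ / 400 * (r / ρ) ≤ v' := by
  have hρ : 0 < ρ := hr.trans_le hrρ
  have hℓ : 0 < ℓ := by linarith
  set A : Set ℝ := (Set.Icc α (α + ℓ) \ B) \ {t | ∃ u ∈ U, |u - t| ≤ 2 * ρ} with hA
  obtain ⟨P, hPA, hPs, hPc, hPv⟩ := exists_separated_finset (A := A) (σ := 100 * ρ)
    (by positivity) hℓ.le (fun t ht => ht.1.1)
  have hcard : ℓ / (800 * ρ) ≤ P.card := by
    have h1 : Set.Icc α (α + ℓ) ⊆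
        (Set.Icc α (α + ℓ) ∩ B) ∪ ({t | ∃ u ∈ U, |u - t| ≤ 2 * ρ} ∪ A) := by
      intro t ht
      by_cases h1 : t ∈ B
      · exact Or.inl ⟨ht, h1⟩
      by_cases h2 : t ∈ {t | ∃ u ∈ U, |u - t| ≤ 2 * ρ}
      · exact Or.inr (Or.inl h2)
      · exact Or.inr (Or.inr ⟨⟨ht, h1⟩, h2⟩)
    have h2 := (measure_mono h1).trans (measure_union_le (μ := volume) _ _)
    have h3 := h2.trans (add_le_add hB ((measure_union_le _ _).trans
      (add_le_add (hth (2 * ρ) (by positivity)) hPv)))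
    rw [Real.volume_Icc, add_sub_cancel_left, ← ENNReal.ofReal_add (by positivity) (by positivity),
      ← ENNReal.ofReal_add (by positivity) (by positivity),
      ENNReal.ofReal_le_ofReal_iff (by positivity)] at h3
    rw [div_le_iff₀ (by positivity)]
    nlinarith
  choose! c hc1 hc2 using hc
  have hPB : ∀ p ∈ P, p ∉ B := fun p hp => (hPA hp).1.2
  have hPI : ∀ p ∈ P, p ∈ Set.Icc α (α + ℓ) := fun p hp => (hPA hp).1.1
  have hPU : ∀ p ∈ P, ∀ u ∈ U, 2 * ρ < |u - p| := fun p hp u hu => by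
    by_contra! h
    exact (hPA hp).2 ⟨u, hu, h⟩
  set W : Set ℝ := ⋃ p ∈ P, Metric.closedBall (c p) r with hW
  have hWm : MeasurableSet W :=
    Finset.measurableSet_biUnion _ fun p _ => Metric.isClosed_closedBall.measurableSet
  have hWv : volume W = ENNReal.ofReal (P.card * (2 * r)) := by
    rw [hW, measure_biUnion_finset]
    · simp only [Real.volume_closedBall, Finset.sum_const, nsmul_eq_mul]
      rw [ENNReal.ofReal_mul (Nat.cast_nonneg _), ENNReal.ofReal_natCast]
    · intro p hp p' hp' hne
      refine Metric.closedBall_disjoint_closedBall ?_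
      have h1 := hPs p hp p' hp' hne
      have h2 := hc1 p (hPB p hp)
      have h3 := hc1 p' (hPB p' hp')
      rw [Real.dist_eq]
      have h4 := abs_sub_le p (c p) p'
      have h5 := abs_sub_le (c p) (c p') p'
      rw [abs_sub_comm] at h2
      linarith
    · exact fun p _ => Metric.isClosed_closedBall.measurableSet
  have hdisj : Disjoint U W := by
    rw [Set.disjoint_left]
    intro u hu huW
    simp only [hW, Set.mem_iUnion, Metric.mem_closedBall, Real.dist_eq] at huW
    obtain ⟨p, hp, hup⟩ := huW
    have h1 := hPU p hp u hu
    have h2 := hc1 p (hPB p hp)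
    have h3 := abs_sub_le u (c p) p
    linarith
  refine ⟨U ∪ W, v + P.card * (2 * r), N + P.card, hU.union hWm, Set.union_subset hUV ?_,
    by positivity, ?_, by positivity, ?_, ?_, ?_⟩
  · intro w hw
    simp only [hW, Set.mem_iUnion] at hw
    obtain ⟨p, hp, hwp⟩ := hw
    refine ⟨hc2 p (hPB p hp) hwp, ?_⟩
    rw [Metric.mem_closedBall, Real.dist_eq] at hwp
    have h1 := abs_le.1 hwp
    have h2 := abs_le.1 (hc1 p (hPB p hp))
    have h3 := hPI p hp
    constructor <;> linarith [h3.1, h3.2]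
  · rw [measure_union hdisj hWm, hUv, hWv, ← ENNReal.ofReal_add hv0 (by positivity)]
  · intro τ hτ
    have h1 : {t | ∃ u ∈ U ∪ W, |u - t| ≤ τ} ⊆ {t | ∃ u ∈ U, |u - t| ≤ τ} ∪
        ⋃ p ∈ P, Metric.closedBall (c p) (r + τ) := by
      rintro t ⟨u, hu | hu, hut⟩
      · exact Or.inl ⟨u, hu, hut⟩
      · right
        simp only [hW, Set.mem_iUnion, Metric.mem_closedBall, Real.dist_eq] at hu ⊢
        obtain ⟨p, hp, hup⟩ := hu
        refine ⟨p, hp, ?_⟩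
        have h3 := abs_sub_le t u (c p)
        rw [abs_sub_comm] at hut
        linarith
    refine (measure_mono h1).trans ((measure_union_le _ _).trans ((add_le_add (hth τ hτ)
      (measure_biUnion_finset_le _ _)).trans ?_))
    simp only [Real.volume_closedBall, Finset.sum_const, nsmul_eq_mul]
    rw [← ENNReal.ofReal_natCast, ← ENNReal.ofReal_mul (Nat.cast_nonneg _),
      ← ENNReal.ofReal_add (by positivity) (by positivity)]
    exact ENNReal.ofReal_le_ofReal (by linarith)
  · have h1 : 1 ≤ ℓ / (100 * ρ) := by rw [one_le_div (by positivity)]; exact hρℓ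
    have h2 : 2 * ℓ / 100 * (1 / ρ) = ℓ / (100 * ρ) + ℓ / (100 * ρ) := by field_simp; ring
    linarith
  · have h1 : ℓ / 400 * (r / ρ) = ℓ / (800 * ρ) * (2 * r) := by field_simp; ring
    rw [h1]
    gcongr

/-- A set containing a ball of radius `r m` within distance `ρ m` of most points for each `m ∈ G`
has a large part near the interval, provided that `∑ r m / ρ m = ∞`. -/
lemma exists_large_subset_of_not_summable {V : Set ℝ} {B : ℕ → Set ℝ} {G : Set ℕ} {α ℓ : ℝ}
    {ρ r : ℕ → ℝ} (hℓ : 0 < ℓ) (hr : ∀ m ∈ G, 0 < r m) (hrρ : ∀ m ∈ G, r m ≤ ρ m)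
    (hρℓ : ∀ m ∈ G, 100 * ρ m ≤ ℓ)
    (hB : ∀ m ∈ G, volume (Set.Icc α (α + ℓ) ∩ B m) ≤ ENNReal.ofReal (ℓ / 2))
    (hc : ∀ m ∈ G, ∀ t ∉ B m, ∃ s, |s - t| ≤ ρ m ∧ Metric.closedBall s (r m) ⊆ V)
    (hsum : ∀ m ∈ G, ∑ k ∈ Finset.range m, G.indicator (fun k => 1 / ρ k) k ≤ 1 / ρ m)
    (hdiv : ¬ Summable (G.indicator fun k => r k / ρ k)) :
    ∃ U, MeasurableSet U ∧ U ⊆ V ∩ Set.Icc (α - ℓ) (α + 2 * ℓ) ∧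
      ENNReal.ofReal (ℓ / 10) ≤ volume U := by
  by_contra! hcon
  have hind : ∀ n, ∃ (U : Set ℝ) (v N : ℝ), MeasurableSet U ∧
      U ⊆ V ∩ Set.Icc (α - ℓ) (α + 2 * ℓ) ∧ 0 ≤ v ∧ volume U = ENNReal.ofReal v ∧ 0 ≤ N ∧
      (∀ τ : ℝ, 0 ≤ τ → volume {t | ∃ u ∈ U, |u - t| ≤ τ} ≤ ENNReal.ofReal (v + 2 * τ * N)) ∧
      N ≤ 2 * ℓ / 100 * ∑ k ∈ Finset.range n, G.indicator (fun k => 1 / ρ k) k ∧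
      ℓ / 400 * ∑ k ∈ Finset.range n, G.indicator (fun k => r k / ρ k) k ≤ v := by
    intro n
    induction n with
    | zero => exact ⟨∅, 0, 0, by simp⟩
    | succ m ih =>
      obtain ⟨U, v, N, hU, hUV, hv0, hUv, hN0, hth, hN, hv⟩ := ih
      by_cases hm : m ∈ G
      · have hvℓ : v ≤ ℓ / 10 := by
          have := hcon U hU hUV
          rw [hUv, ENNReal.ofReal_lt_ofReal_iff (by positivity)] at this
          exact this.le
        have hρ : 0 < ρ m := (hr m hm).trans_le (hrρ m hm)
        have hNρ : N * ρ m ≤ 2 * ℓ / 100 := by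
          have h1 : N ≤ 2 * ℓ / 100 * (1 / ρ m) := hN.trans (by gcongr; exact hsum m hm)
          calc N * ρ m ≤ 2 * ℓ / 100 * (1 / ρ m) * ρ m := by gcongr
            _ = _ := by field_simp
        obtain ⟨U', v', N', h1, h2, h3, h4, h5, h6, h7, h8⟩ := exists_extension_by_balls
          (hr m hm) (hrρ m hm) (hρℓ m hm) (hB m hm) (hc m hm) hU hUV hv0 hUv hN0 hth hvℓ hNρ
        refine ⟨U', v', N', h1, h2, h3, h4, h5, h6, ?_, ?_⟩
        · rw [Finset.sum_range_succ, Set.indicator_of_mem hm]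
          linarith
        · rw [Finset.sum_range_succ, Set.indicator_of_mem hm]
          linarith
      · refine ⟨U, v, N, hU, hUV, hv0, hUv, hN0, hth, ?_, ?_⟩ <;>
          rw [Finset.sum_range_succ, Set.indicator_of_notMem hm, add_zero] <;> assumption
  rw [not_summable_iff_tendsto_nat_atTop_of_nonneg] at hdiv
  · obtain ⟨n, hn⟩ := (hdiv.eventually_gt_atTop 40).exists
    obtain ⟨U, v, N, hU, hUV, hv0, hUv, hN0, hth, hN, hv⟩ := hind n
    have h1 := hcon U hU hUV
    rw [hUv, ENNReal.ofReal_lt_ofReal_iff (by positivity)] at h1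
    nlinarith
  · intro k
    exact Set.indicator_nonneg (fun k hk => div_nonneg (hr k hk).le
      ((hr k hk).trans_le (hrρ k hk)).le) k

lemma ae_mem_of_forall_exists_large_subset {V : Set ℝ} {c : ℝ} (hc : 0 < c)
    (h : ∀ x R : ℝ, 0 < R → R < 1 → ∃ U, MeasurableSet U ∧ U ⊆ V ∩ Set.Icc (x - R) (x + R) ∧
      ENNReal.ofReal (c * R) ≤ volume U) : ∀ᵐ x, x ∈ V := by
  have hnull : ∀ᵐ _x ∂(volume.restrict Vᶜ : Measure ℝ), False := by
    filter_upwards [Besicovitch.ae_tendsto_measure_inter_div (volume : Measure ℝ) Vᶜ] with x hx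
    have hle : ∀ᶠ R in nhdsWithin (0 : ℝ) (Set.Ioi 0),
        volume (Vᶜ ∩ Metric.closedBall x R) / volume (Metric.closedBall x R) ≤
          ENNReal.ofReal (1 - c / 2) := by
      filter_upwards [Ioo_mem_nhdsGT (zero_lt_one' ℝ)] with R hR
      obtain ⟨U, hU, hUV, hUc⟩ := h x R hR.1 hR.2
      rw [← Real.closedBall_eq_Icc] at hUV
      have h1 : volume (Vᶜ ∩ Metric.closedBall x R) ≤ ENNReal.ofReal (2 * R - c * R) := by
        calc volume (Vᶜ ∩ Metric.closedBall x R) ≤ volume (Metric.closedBall x R \ U) :=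
              measure_mono fun t ht => ⟨ht.2, fun hU' => ht.1 (hUV hU').1⟩
          _ = volume (Metric.closedBall x R) - volume U := by
              refine measure_sdiff (fun t ht => (hUV ht).2) hU.nullMeasurableSet ?_
              exact ((measure_mono fun t ht => (hUV ht).2).trans_lt measure_closedBall_lt_top).ne
          _ ≤ ENNReal.ofReal (2 * R) - ENNReal.ofReal (c * R) := by
              rw [Real.volume_closedBall]; gcongr
          _ = _ := (ENNReal.ofReal_sub _ (by nlinarith [hR.1])).symm
      rw [Real.volume_closedBall]
      refine (ENNReal.div_le_div_right h1 _).trans ?_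
      rw [← ENNReal.ofReal_div_of_pos (by linarith [hR.1])]
      refine ENNReal.ofReal_le_ofReal (le_of_eq ?_)
      have := hR.1.ne'
      field_simp
    have h1 := le_of_tendsto hx hle
    rw [← ENNReal.ofReal_one, ENNReal.ofReal_le_ofReal_iff'] at h1
    rcases h1 with h1 | h1 <;> linarith
  rw [ae_iff]
  have h0 : volume Vᶜ = 0 := by simpa [Filter.eventually_false_iff_eq_bot, ae_eq_bot] using hnull
  exact h0

lemma exists_le_forall_lt_le (μ : ℕ → ℝ) (n : ℕ) :
    ∃ k ≤ n, (∀ j < k, μ j ≤ μ k) ∧ μ n ≤ μ k := by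
  induction n using Nat.strong_induction_on with
  | _ n ih =>
    by_cases h : ∀ j < n, μ j ≤ μ n
    · exact ⟨n, le_rfl, h, le_rfl⟩
    · push Not at h
      obtain ⟨j, hj, hnj⟩ := h
      obtain ⟨k, hk, h1, h2⟩ := ih j hj
      exact ⟨k, hk.trans hj.le, h1, hnj.le.trans h2⟩

lemma not_summable_indicator_record {μ : ℕ → ℝ} (hμ : ∀ n, 0 < μ n)
    (hdiv : ¬ Summable fun n => μ n ^ 2 / 2 ^ n) (n₀ : ℕ) :
    ¬ Summable ({m | n₀ ≤ m ∧ (∀ k < m, μ k ≤ μ m) ∧ ((m : ℝ) + 1) ^ 6 ≤ μ m}.indicator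
      fun n => μ n ^ 2 / 2 ^ n) := by
  classical
  intro hG
  refine hdiv ?_
  set f : ℕ → ℝ := fun n => μ n ^ 2 / 2 ^ n with hf
  have hf0 : ∀ n, 0 ≤ f n := fun n => by positivity
  set G : Set ℕ := {m | n₀ ≤ m ∧ (∀ k < m, μ k ≤ μ m) ∧ ((m : ℝ) + 1) ^ 6 ≤ μ m} with hGdef
  set H : Set ℕ := {m | ∀ k < m, μ k ≤ μ m} with hHdef
  have hpoly := summable_add_one_pow_mul_geometric 12 (r := 1 / 2) (by norm_num) (by norm_num)
  have hfin : Summable ((Set.Iio n₀).indicator f) :=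
    summable_of_ne_finset_zero (s := Finset.range n₀) fun b hb => by
      rw [Set.indicator_of_notMem]; simpa using hb
  have hH : Summable (H.indicator f) := by
    refine Summable.of_nonneg_of_le (fun n => Set.indicator_nonneg (fun k _ => hf0 k) n) ?_
      ((hG.add hfin).add hpoly)
    intro n
    have h1 : 0 ≤ G.indicator f n := Set.indicator_nonneg (fun k _ => hf0 k) n
    have h2 : 0 ≤ (Set.Iio n₀).indicator f n := Set.indicator_nonneg (fun k _ => hf0 k) n
    have h3 : 0 ≤ ((n : ℝ) + 1) ^ 12 * (1 / 2) ^ n := by positivity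
    by_cases hn : n ∈ H
    · rw [Set.indicator_of_mem hn]
      by_cases hn0 : n < n₀
      · rw [Set.indicator_of_mem (s := Set.Iio n₀) hn0]
        linarith
      by_cases hnμ : ((n : ℝ) + 1) ^ 6 ≤ μ n
      · rw [Set.indicator_of_mem (s := G) ⟨not_lt.1 hn0, hn, hnμ⟩]
        linarith
      · have h4 : f n ≤ ((n : ℝ) + 1) ^ 12 * (1 / 2) ^ n := by
          rw [one_div, inv_pow, ← div_eq_mul_inv, hf]
          have h5 := (hμ n).le
          push Not at hnμ
          calc μ n ^ 2 / 2 ^ n ≤ (((n : ℝ) + 1) ^ 6) ^ 2 / 2 ^ n := by gcongr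
            _ = _ := by rw [← pow_mul]
        linarith
    · rw [Set.indicator_of_notMem hn]
      positivity
  have hgeo : Summable fun n : ℕ => ‖(1 / 2 : ℝ) ^ n‖ := by
    simpa using (summable_geometric_two : Summable fun n : ℕ => (1 / 2 : ℝ) ^ n)
  refine Summable.of_nonneg_of_le hf0 (fun n => ?_)
    (summable_norm_sum_mul_antidiagonal_of_summable_norm hH.norm hgeo)
  obtain ⟨k, hkn, hk, hμk⟩ := exists_le_forall_lt_le μ n
  refine le_trans ?_ (le_abs_self _)
  refine le_trans ?_ (Finset.single_le_sum (f := fun kl : ℕ × ℕ => H.indicator f kl.1 *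
    (1 / 2 : ℝ) ^ kl.2) (a := (k, n - k)) (fun kl _ => mul_nonneg
      (Set.indicator_nonneg (fun k _ => hf0 k) _) (by positivity)) ?_)
  · rw [Set.indicator_of_mem (s := H) hk]
    have h5 := (hμ n).le
    calc f n ≤ μ k ^ 2 / 2 ^ n := by simp only [hf]; gcongr
      _ = μ k ^ 2 / 2 ^ k * (1 / 2) ^ (n - k) := by
        rw [one_div, inv_pow, ← div_eq_mul_inv, div_div, ← pow_add]
        congr 3; omega
  · rw [Finset.HasAntidiagonal.mem_antidiagonal]; dsimp only; omega

lemma ae_frequently_mem_scaleHit {δ : ℕ → ℝ} (hδ : ∀ n, 0 < δ n)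
    (hδn : ∀ n, 2 ^ n * δ n ^ 2 ≤ 1) (hdiv : ¬ Summable fun n => 2 ^ n * δ n ^ 2) :
    ∀ᵐ t : ℝ, ∃ᶠ n in atTop, t ∈ scaleHit 14 n (δ n) := by
  have hδ1 : ∀ n, δ n ≤ 1 := fun n => by
    have h1 : (1 : ℝ) ≤ 2 ^ n := one_le_pow₀ (by norm_num)
    have h2 := hδn n
    have h3 := hδ n
    by_contra! h4
    nlinarith
  simp only [frequently_atTop]
  rw [ae_all_iff]
  intro n₀
  suffices h : ∀ᵐ t, t ∈ {t | ∃ n ≥ n₀, t ∈ scaleHit 14 n (δ n)} from h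
  refine ae_mem_of_forall_exists_large_subset (c := 1 / 15) (by norm_num) fun x R hR hR1 => ?_
  set μ : ℕ → ℝ := fun n => 2 ^ n * δ n with hμdef
  have hμ0 : ∀ n, 0 < μ n := fun n => mul_pos (by positivity) (hδ n)
  set ℓ : ℝ := 2 / 3 * R with hℓdef
  have hℓ : 0 < ℓ := by positivity
  have hℓ1 : ℓ ≤ 1 := by linarith
  obtain ⟨n₁, hn₁⟩ := exists_nat_ge (150000 / ℓ)
  have hdiv' : ¬ Summable fun n => μ n ^ 2 / 2 ^ n := by
    convert hdiv using 3 with n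
    simp only [hμdef]
    field_simp
  have hrec := not_summable_indicator_record hμ0 hdiv' (max (max n₀ 14) n₁)
  set G : Set ℕ := {m | max (max n₀ 14) n₁ ≤ m ∧ (∀ k < m, μ k ≤ μ m) ∧
    ((m : ℝ) + 1) ^ 6 ≤ μ m} with hG
  have hGn : ∀ m ∈ G, n₀ ≤ m ∧ 14 ≤ m ∧ 150000 ≤ ℓ * (m + 1) := fun m hm => by
    have h1 : n₀ ≤ m := by have := hm.1; omega
    have h2 : 14 ≤ m := by have := hm.1; omega
    have h3 : n₁ ≤ m := by have := hm.1; omega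
    have h4 : 150000 / ℓ ≤ m := hn₁.trans (by exact_mod_cast h3)
    rw [div_le_iff₀ hℓ] at h4
    exact ⟨h1, h2, by linarith⟩
  have hGμ : ∀ m ∈ G, (15 : ℝ) ^ 6 ≤ μ m := fun m hm => by
    have h1 : (14 : ℝ) ≤ m := by exact_mod_cast (hGn m hm).2.1
    calc (15 : ℝ) ^ 6 ≤ ((m : ℝ) + 1) ^ 6 := by gcongr; linarith
      _ ≤ μ m := hm.2.2
  suffices h : ∃ U, MeasurableSet U ∧ U ⊆ {t | ∃ n ≥ n₀, t ∈ scaleHit 14 n (δ n)} ∩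
      Set.Icc (x - R / 3 - ℓ) (x - R / 3 + 2 * ℓ) ∧ ENNReal.ofReal (ℓ / 10) ≤ volume U by
    rwa [show x - R / 3 - ℓ = x - R by simp only [hℓdef]; ring,
      show x - R / 3 + 2 * ℓ = x + R by simp only [hℓdef]; ring,
      show ℓ / 10 = 1 / 15 * R by simp only [hℓdef]; ring] at h
  refine exists_large_subset_of_not_summable
    (B := fun m => ⋃ i ∈ Finset.range (m - 14), dyadicNear i (4 / (2 ^ m * δ m)) (δ m))
    (G := G) (ρ := fun m => 4 * 2 ^ 14 / (μ m * 2 ^ m))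
    (r := fun m => δ m / 2 ^ m) hℓ (fun m _ => div_pos (hδ m) (by positivity)) ?_ ?_ ?_ ?_ ?_ ?_
  · intro m _
    have h0 := hμ0 m
    rw [div_le_div_iff₀ (by positivity) (by positivity)]
    have h1 : δ m * μ m ≤ 1 := by
      have : δ m * μ m = 2 ^ m * δ m ^ 2 := by simp only [hμdef]; ring
      rw [this]; exact hδn m
    calc δ m * (μ m * 2 ^ m) = δ m * μ m * 2 ^ m := by ring
      _ ≤ 4 * 2 ^ 14 * 2 ^ m := by
        refine mul_le_mul_of_nonneg_right ?_ (by positivity)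
        linarith
  · intro m hm
    have h0 := hμ0 m
    have h1 := hGμ m hm
    have h2 := (hGn m hm).2.2
    have h3 : (m : ℝ) + 1 ≤ 2 ^ m := by exact_mod_cast (Nat.lt_two_pow_self (n := m))
    rw [← mul_div_assoc, div_le_iff₀ (by positivity)]
    calc (100 : ℝ) * (4 * 2 ^ 14) ≤ 15 ^ 6 * 150000 := by norm_num
      _ ≤ μ m * (ℓ * (m + 1)) := by gcongr
      _ ≤ μ m * (ℓ * 2 ^ m) := by gcongr
      _ = _ := by ring
  · intro m hm
    obtain ⟨-, h2, h3⟩ := hGn m hm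
    exact volume_Icc_inter_iUnion_dyadicNear_le h2 (hδ m) (hδn m) hm.2.2 hℓ hℓ1 h3
  · intro m hm t ht
    obtain ⟨h1, h2, -⟩ := hGn m hm
    simp only [Set.mem_iUnion, Finset.mem_range, not_exists] at ht
    obtain ⟨s, hs1, hs2⟩ := exists_center_of_notMem_dyadicNear h2 (hδ m) (hδ1 m)
      ((by norm_num : (16 : ℝ) * 2 ^ 14 ≤ 15 ^ 6).trans (hGμ m hm)) ht
    exact ⟨s, hs1, fun t' ht' => ⟨m, h1, hs2 t' (by
      rwa [Metric.mem_closedBall, Real.dist_eq] at ht')⟩⟩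
  · intro m hm
    have h0 := hμ0 m
    calc ∑ k ∈ Finset.range m, G.indicator (fun k => 1 / (4 * 2 ^ 14 / (μ k * 2 ^ k))) k
        ≤ ∑ k ∈ Finset.range m, μ m / (4 * 2 ^ 14) * 2 ^ k := by
          refine Finset.sum_le_sum fun k hk => ?_
          have hk' := hμ0 k
          by_cases hkG : k ∈ G
          · rw [Set.indicator_of_mem hkG, one_div_div, mul_div_right_comm]
            have := hm.2.1 k (Finset.mem_range.1 hk)
            gcongr
          · rw [Set.indicator_of_notMem hkG]
            positivity
      _ ≤ μ m / (4 * 2 ^ 14) * 2 ^ m := by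
          rw [← Finset.mul_sum, geom_sum_eq (by norm_num)]
          gcongr
          linarith
      _ = _ := by rw [one_div_div]; ring
  · intro hs
    refine hrec ((hs.mul_left (4 * 2 ^ 14)).congr fun m => ?_)
    by_cases hm : m ∈ G
    · rw [Set.indicator_of_mem hm, Set.indicator_of_mem hm]
      have := hμ0 m
      simp only [hμdef]
      field_simp
    · rw [Set.indicator_of_notMem hm, Set.indicator_of_notMem hm, mul_zero]

lemma ae_mem_simApprox2_of_not_summable {φ : ℝ → ℝ} (hφ : IsApproxFun φ)
    (hdiv : ¬ Summable fun h : ℕ => φ h ^ 2) : ∀ᵐ t : ℝ, (t, t ^ 2) ∈ SimApprox2 φ := by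
  have hφ0 : ∀ n : ℕ, 0 < φ (2 ^ n) := fun n => hφ.2 _ (by positivity)
  have key : ∀ k : ℕ, ∀ᵐ t : ℝ, |t| ≤ k → (t, t ^ 2) ∈ SimApprox2 φ := by
    intro k
    set δ : ℕ → ℝ := fun n => min (φ (2 ^ n) / (4 + 2 * k)) (1 / √(2 ^ n)) with hδ
    have hδ0 : ∀ n, 0 < δ n := fun n => lt_min (div_pos (hφ0 n) (by positivity)) (by positivity)
    have hb : ∀ n : ℕ, (2 : ℝ) ^ n * (1 / √(2 ^ n)) ^ 2 = 1 := fun n => by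
      rw [div_pow, Real.sq_sqrt (by positivity)]
      field_simp
    have hδn : ∀ n, 2 ^ n * δ n ^ 2 ≤ 1 := fun n => by
      rw [← hb n]
      have := (hδ0 n).le
      gcongr
      exact min_le_right _ _
    have hδdiv : ¬ Summable fun n => 2 ^ n * δ n ^ 2 := by
      intro hs
      refine hdiv (hφ.summable_sq_iff.2 ?_)
      have h1 := hs.mul_left ((4 + 2 * (k : ℝ)) ^ 2)
      refine h1.congr_atTop ?_
      filter_upwards [hs.tendsto_atTop_zero.eventually_lt_const one_pos] with n hn
      have h2 : δ n = φ (2 ^ n) / (4 + 2 * k) := by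
        refine min_eq_left (le_of_not_ge fun h => ?_)
        have h3 : δ n = 1 / √(2 ^ n) := min_eq_right h
        rw [h3, hb] at hn
        exact lt_irrefl _ hn
      rw [h2]
      field_simp
    filter_upwards [ae_frequently_mem_scaleHit hδ0 hδn hδdiv] with t ht htk
    refine Set.infinite_of_forall_exists_gt fun N => ?_
    obtain ⟨n, hn, q, y, x, hq, hqn, hy, hx⟩ := frequently_atTop.1 ht (N + 14)
    have hNq : (N : ℝ) < q := by
      have h1 : N < 2 ^ (n - 14) :=
        (by omega : N ≤ n - 14).trans_lt Nat.lt_two_pow_self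
      exact (by exact_mod_cast h1 : (N : ℝ) < 2 ^ (n - 14)).trans_le hq
    have hq0' : (0 : ℝ) < q := (Nat.cast_nonneg N).trans_lt hNq
    have hq0 : 0 < q := by exact_mod_cast hq0'
    lift q to ℕ using hq0.le
    simp only [Int.cast_natCast] at *
    have hδq : (4 + 2 * k) * δ n ≤ φ q := by
      have h1 : δ n ≤ φ (2 ^ n) / (4 + 2 * k) := min_le_left _ _
      rw [le_div_iff₀ (by positivity)] at h1
      linarith [hφ.1 q (2 ^ n) hq0' hqn]
    have hδk : 0 ≤ δ n * k := mul_nonneg (hδ0 n).le (Nat.cast_nonneg k)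
    refine ⟨q, ⟨by exact_mod_cast hq0, max_lt ?_ ?_⟩, by exact_mod_cast hNq⟩
    · refine (distNearestInt_le _ y).trans_lt ?_
      rw [abs_sub_comm]
      linarith [hδ0 n]
    · refine (distNearestInt_le _ x).trans_lt ?_
      have h1 : (q : ℝ) * t ^ 2 - x = -(x - 2 * t * y + t ^ 2 * q) - 2 * t * (y - q * t) := by ring
      have h2 : |2 * t * ((y : ℝ) - q * t)| ≤ 2 * k * δ n := by
        rw [abs_mul, abs_mul, abs_two]
        gcongr
      rw [h1]
      refine (abs_sub _ _).trans_lt ?_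
      rw [abs_neg]
      linarith [hδ0 n]
  filter_upwards [ae_all_iff.2 key] with t ht
  exact ht ⌈|t|⌉₊ (Nat.le_ceil _)

lemma IsApproxFun.rescale {φ : ℝ → ℝ} (hφ : IsApproxFun φ) {c : ℝ} (hc : 0 < c) :
    IsApproxFun fun x => c * φ (x / c) := by
  refine ⟨fun x y hx hxy => ?_, fun x hx => mul_pos hc (hφ.2 _ (by positivity))⟩
  have := hφ.1 (x / c) (y / c) (by positivity) (by gcongr)
  simp only
  gcongr

lemma IsApproxFun.summable_sq_rescale {φ : ℝ → ℝ} (hφ : IsApproxFun φ) (j : ℕ)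
    (hs : Summable fun h : ℕ => φ h ^ 2) :
    Summable fun h : ℕ => (2 ^ j * φ ((h : ℝ) / 2 ^ j)) ^ 2 := by
  rw [(hφ.rescale (by positivity : (0 : ℝ) < 2 ^ j)).summable_sq_iff, ← summable_nat_add_iff j]
  rw [hφ.summable_sq_iff] at hs
  refine (hs.mul_left (2 ^ j * (2 ^ j) ^ 2)).congr fun n => ?_
  rw [pow_add (2 : ℝ) n j, mul_div_assoc, div_self (by positivity), mul_one]
  ring

lemma exists_simApprox2_transfer (L : Matrix (Fin 3) (Fin 3) ℤ) {u v : ℝ × ℝ} {c : ℝ} (hc : c ≠ 0)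
    (h0 : L 0 0 + L 0 1 * u.1 + L 0 2 * u.2 = c) (h1 : L 1 0 + L 1 1 * u.1 + L 1 2 * u.2 = c * v.1)
    (h2 : L 2 0 + L 2 1 * u.1 + L 2 2 * u.2 = c * v.2) (b : ℝ) :
    ∃ j : ℕ, ∀ φ, IsApproxFun φ → φ 1 ≤ b → u ∈ SimApprox2 φ →
      v ∈ SimApprox2 fun x => 2 ^ j * φ (x / 2 ^ j) := by
  set K : ℝ := ∑ i, (|(L i 1 : ℝ)| + |(L i 2 : ℝ)|) with hK
  have hKi : ∀ i, |(L i 1 : ℝ)| + |(L i 2 : ℝ)| ≤ K := fun i =>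
    Finset.single_le_sum (f := fun i => |(L i 1 : ℝ)| + |(L i 2 : ℝ)|)
      (fun i _ => by positivity) (Finset.mem_univ i)
  have hK0 : 0 ≤ K := Finset.sum_nonneg fun i _ => by positivity
  have hc0 : 0 < |c| := abs_pos.2 hc
  obtain ⟨j, hj⟩ := pow_unbounded_of_one_lt
    (|c| + K * |b| + K * (1 + |v.1|) + K * (1 + |v.2|)) (one_lt_two : (1 : ℝ) < 2)
  have hKb : 0 ≤ K * |b| := by positivity
  have hK1 : 0 ≤ K * (1 + |v.1|) := by positivity
  have hK2 : 0 ≤ K * (1 + |v.2|) := by positivity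
  refine ⟨j, fun φ hφ hφb hu => Set.infinite_of_forall_exists_gt fun N => ?_⟩
  obtain ⟨q, ⟨hq0, hq⟩, hqN⟩ := hu.exists_gt ⌈(N + K * |b|) / |c|⌉₊
  rw [max_lt_iff] at hq
  have hqN' : N + K * |b| < |c| * q := by
    have := (Nat.le_ceil ((N + K * |b|) / |c|)).trans_lt (Nat.cast_lt.2 hqN)
    rwa [div_lt_iff₀' hc0] at this
  have hq1 : (1 : ℝ) ≤ q := by exact_mod_cast hq0
  have hφq0 : 0 < φ q := hφ.2 _ (by linarith)
  have hφq : φ q ≤ |b| := (hφ.1 1 q one_pos hq1).trans (hφb.trans (le_abs_self b))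
  set e₁ : ℝ := round (q * u.1) - q * u.1 with he₁
  set e₂ : ℝ := round (q * u.2) - q * u.2 with he₂
  have he₁φ : |e₁| < φ q := by rw [he₁, abs_sub_comm]; exact hq.1
  have he₂φ : |e₂| < φ q := by rw [he₂, abs_sub_comm]; exact hq.2
  have herr : ∀ i, |(L i 1 : ℝ) * e₁ + L i 2 * e₂| ≤ K * φ q := fun i => by
    refine (abs_add_le _ _).trans ?_
    rw [abs_mul, abs_mul]
    calc |(L i 1 : ℝ)| * |e₁| + |(L i 2 : ℝ)| * |e₂|
        ≤ |(L i 1 : ℝ)| * φ q + |(L i 2 : ℝ)| * φ q := by gcongr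
      _ = (|(L i 1 : ℝ)| + |(L i 2 : ℝ)|) * φ q := by ring
      _ ≤ K * φ q := by gcongr; exact hKi i
  set z : Fin 3 → ℤ := fun i => L i 0 * q + L i 1 * round (q * u.1) + L i 2 * round (q * u.2)
    with hz
  have hz0 : (z 0 : ℝ) - c * q = L 0 1 * e₁ + L 0 2 * e₂ := by
    simp only [hz, he₁, he₂]; push_cast; linear_combination (q : ℝ) * h0
  have hz1 : (z 1 : ℝ) - c * v.1 * q = L 1 1 * e₁ + L 1 2 * e₂ := by
    simp only [hz, he₁, he₂]; push_cast; linear_combination (q : ℝ) * h1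
  have hz2 : (z 2 : ℝ) - c * v.2 * q = L 2 1 * e₁ + L 2 2 * e₂ := by
    simp only [hz, he₁, he₂]; push_cast; linear_combination (q : ℝ) * h2
  have herr0 := herr 0
  have herr1 := herr 1
  have herr2 := herr 2
  rw [← hz0] at herr0
  rw [← hz1] at herr1
  rw [← hz2] at herr2
  have hKφ : K * φ q ≤ K * |b| := by gcongr
  have habs : |c * q| = |c| * q := by rw [abs_mul, Nat.abs_cast]
  have hlow : (N : ℝ) < |(z 0 : ℝ)| := by
    have := abs_sub_abs_le_abs_sub (c * q) (z 0 : ℝ)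
    rw [abs_sub_comm, habs] at this
    linarith
  have hz0pos : 0 < |(z 0 : ℝ)| := (Nat.cast_nonneg N).trans_lt hlow
  have hup : |(z 0 : ℝ)| / 2 ^ j ≤ q := by
    rw [div_le_iff₀' (by positivity)]
    have := abs_sub_abs_le_abs_sub (z 0 : ℝ) (c * q)
    rw [habs] at this
    have h3 : K * |b| ≤ K * |b| * q := le_mul_of_one_le_right hKb hq1
    calc |(z 0 : ℝ)| ≤ (|c| + K * |b|) * q := by linarith
      _ ≤ 2 ^ j * q := by gcongr; linarith
  have hφz : φ q ≤ φ (|(z 0 : ℝ)| / 2 ^ j) := hφ.1 _ _ (by positivity) hup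
  have hcast : (((z 0).natAbs : ℕ) : ℝ) = |(z 0 : ℝ)| := by rw [Nat.cast_natAbs, Int.cast_abs]
  have hfinal : ∀ (w : ℝ) (y : ℤ), |(y : ℝ) - c * w * q| ≤ K * φ q → K * (1 + |w|) < 2 ^ j →
      distNearestInt (((z 0).natAbs : ℕ) * w) < 2 ^ j * φ ((((z 0).natAbs : ℕ) : ℝ) / 2 ^ j) := by
    intro w y hy hw
    have h3 : |(z 0 : ℝ) * w - y| < 2 ^ j * φ (|(z 0 : ℝ)| / 2 ^ j) := by
      have h4 : (z 0 : ℝ) * w - y = (z 0 - c * q) * w - (y - c * w * q) := by ring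
      calc |(z 0 : ℝ) * w - y| ≤ |((z 0 : ℝ) - c * q) * w| + |(y : ℝ) - c * w * q| := by
            rw [h4]; exact abs_sub _ _
        _ ≤ K * φ q * |w| + K * φ q := by rw [abs_mul]; gcongr
        _ = K * (1 + |w|) * φ q := by ring
        _ < 2 ^ j * φ q := by gcongr
        _ ≤ _ := by gcongr
    rw [hcast]
    rcases abs_choice (z 0 : ℝ) with h4 | h4
    · rw [h4] at h3 ⊢
      exact (distNearestInt_le _ y).trans_lt h3
    · rw [h4] at h3 ⊢
      refine (distNearestInt_le _ (-y)).trans_lt ?_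
      rw [show -(z 0 : ℝ) * w - ((-y : ℤ) : ℝ) = -(z 0 * w - y) by push_cast; ring, abs_neg]
      exact h3
  refine ⟨(z 0).natAbs, ⟨?_, max_lt (hfinal _ _ herr1 (by linarith)) (hfinal _ _ herr2
    (by linarith))⟩, ?_⟩
  · have : (0 : ℝ) < ((z 0).natAbs : ℕ) := by rw [hcast]; exact hz0pos
    exact_mod_cast this
  · have : (N : ℝ) < ((z 0).natAbs : ℕ) := by rw [hcast]; exact hlow
    exact_mod_cast this

lemma hausdorffMeasure_one_image_eq_zero {f : ℝ → ℝ × ℝ} {E : Set ℝ} (hE : volume E = 0)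
    (hf : ∀ t ∈ E, ContDiffAt ℝ 1 f t) : μH[1] (f '' E) = 0 := by
  have h := measure_null_of_locally_null
    (μ := OuterMeasure.comap f (μH[1] : Measure (ℝ × ℝ)).toOuterMeasure) E fun t ht => by
      obtain ⟨K, s, hs, hK⟩ := (hf t ht).exists_lipschitzOnWith
      refine ⟨s ∩ E, inter_mem (mem_nhdsWithin_of_mem_nhds hs) self_mem_nhdsWithin, ?_⟩
      have h1 := (hK.mono Set.inter_subset_left).hausdorffMeasure_image_le (s := s ∩ E) zero_le_one
      rw [hausdorffMeasure_real, measure_mono_null Set.inter_subset_right hE, mul_zero] at h1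
      simpa using h1
  simpa using h

/-- The affine point with homogeneous coordinates `w`. -/
noncomputable def affinePoint (w : Fin 3 → ℝ) : ℝ × ℝ := (w 1 / w 0, w 2 / w 0)

lemma affinePoint_smul {c : ℝ} (hc : c ≠ 0) (w : Fin 3 → ℝ) :
    affinePoint (c • w) = affinePoint w := by
  simp only [affinePoint, Pi.smul_apply, smul_eq_mul, mul_div_mul_left _ _ hc]

/-- The point with parameter `t` on the image of the parabola `y = x²` under the projective
transformation `M`. -/
noncomputable def conicPoint (M : Matrix (Fin 3) (Fin 3) ℝ) (t : ℝ) : ℝ × ℝ :=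
  affinePoint (M.mulVec ![1, t, t ^ 2])

lemma contDiffAt_conicPoint {M : Matrix (Fin 3) (Fin 3) ℝ} {t : ℝ}
    (ht : M.mulVec ![1, t, t ^ 2] 0 ≠ 0) : ContDiffAt ℝ 1 (conicPoint M) t := by
  have h : ∀ i, ContDiffAt ℝ 1 (fun t => M.mulVec ![1, t, t ^ 2] i) t := fun i => by
    simp only [Matrix.mulVec, dotProduct, Fin.sum_univ_three, Matrix.cons_val]
    fun_prop
  exact ((h 1).div (h 0) ht).prodMk ((h 2).div (h 0) ht)

lemma ae_conicPoint_mem_simApprox2 (M : Matrix (Fin 3) (Fin 3) ℤ) {ψ : ℝ → ℝ} (hψ : IsApproxFun ψ)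
    (hdiv : ¬ Summable fun h : ℕ => ψ h ^ 2) :
    ∀ᵐ t : ℝ, (M.map (Int.castRingHom ℝ)).mulVec ![1, t, t ^ 2] 0 ≠ 0 →
      conicPoint (M.map (Int.castRingHom ℝ)) t ∈ SimApprox2 ψ := by
  have hφ : ∀ j : ℕ, IsApproxFun fun x => (2 ^ j)⁻¹ * ψ (x / (2 ^ j)⁻¹) :=
    fun j => hψ.rescale (by positivity)
  have hback : ∀ j : ℕ,
      (fun x => 2 ^ j * ((2 ^ j)⁻¹ * ψ (x / 2 ^ j / (2 ^ j)⁻¹))) = ψ := fun j => by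
    funext x
    rw [mul_inv_cancel_left₀ (by positivity), div_inv_eq_mul, div_mul_cancel₀ _ (by positivity)]
  have key : ∀ j : ℕ, ∀ᵐ t : ℝ,
      (t, t ^ 2) ∈ SimApprox2 fun x => (2 ^ j)⁻¹ * ψ (x / (2 ^ j)⁻¹) := fun j => by
    refine ae_mem_simApprox2_of_not_summable (hφ j) fun hs => hdiv ?_
    have h1 := (hφ j).summable_sq_rescale j hs
    exact h1.congr fun h => by rw [← congrFun (hback j) h]
  filter_upwards [ae_all_iff.2 key] with t ht hc
  obtain ⟨j, hj⟩ := exists_simApprox2_transfer M (u := (t, t ^ 2))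
    (v := conicPoint (M.map (Int.castRingHom ℝ)) t) hc
    (by simp [Matrix.mulVec, dotProduct, Fin.sum_univ_three])
    (by
      rw [conicPoint, affinePoint, mul_div_cancel₀ _ hc]
      simp [Matrix.mulVec, dotProduct, Fin.sum_univ_three])
    (by
      rw [conicPoint, affinePoint, mul_div_cancel₀ _ hc]
      simp [Matrix.mulVec, dotProduct, Fin.sum_univ_three]) (ψ 1)
  have h1 := hj _ (hφ j) ?_ (ht j)
  · rwa [hback] at h1
  · have h2 : (1 : ℝ) ≤ 2 ^ j := one_le_pow₀ (by norm_num)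
    have h3 := hψ.1 1 (1 / (2 ^ j)⁻¹) one_pos (by rwa [one_div, inv_inv])
    have h4 := hψ.2 1 one_pos
    calc (2 ^ j)⁻¹ * ψ (1 / (2 ^ j)⁻¹) ≤ 1 * ψ 1 :=
          mul_le_mul (inv_le_one_of_one_le₀ h2) h3 (hψ.2 _ (by positivity)).le zero_le_one
      _ = ψ 1 := one_mul _

lemma ae_conicPoint_notMem_simApprox2 {M : Matrix (Fin 3) (Fin 3) ℤ} (hM : M.det ≠ 0) {ψ : ℝ → ℝ}
    (hψ : IsApproxFun ψ) (hs : Summable fun h : ℕ => ψ h ^ 2) :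
    ∀ᵐ t : ℝ, (M.map (Int.castRingHom ℝ)).mulVec ![1, t, t ^ 2] 0 ≠ 0 →
      conicPoint (M.map (Int.castRingHom ℝ)) t ∉ SimApprox2 ψ := by
  have key : ∀ j : ℕ, ∀ᵐ t : ℝ, (t, t ^ 2) ∉ SimApprox2 fun x => 2 ^ j * ψ (x / 2 ^ j) := fun j =>
    ae_notMem_simApprox2_of_summable (hψ.rescale (by positivity)) (hψ.summable_sq_rescale j hs)
  filter_upwards [ae_all_iff.2 key] with t ht hc hmem
  set w := (M.map (Int.castRingHom ℝ)).mulVec ![1, t, t ^ 2] with hw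
  have hadj : ((M.adjugate).map (Int.castRingHom ℝ)).mulVec (![1, w 1 / w 0, w 2 / w 0]) =
      ((M.det : ℝ) / w 0) • ![1, t, t ^ 2] := by
    have h1 : ![1, w 1 / w 0, w 2 / w 0] = (w 0)⁻¹ • w := by
      ext i
      fin_cases i <;> simp [hc, div_eq_inv_mul]
    have h2 : (M.adjugate).map (Int.castRingHom ℝ) * M.map (Int.castRingHom ℝ) =
        (M.det : ℝ) • (1 : Matrix (Fin 3) (Fin 3) ℝ) := by
      rw [← Matrix.map_mul, Matrix.adjugate_mul]
      ext i k
      rw [Matrix.map_apply, Matrix.smul_apply, Matrix.smul_apply, Matrix.one_apply,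
        Matrix.one_apply]
      split_ifs <;> simp
    rw [h1, Matrix.mulVec_smul, hw, Matrix.mulVec_mulVec, h2, Matrix.smul_mulVec, Matrix.one_mulVec,
      smul_smul, mul_comm, ← div_eq_mul_inv]
  have hadj' : ∀ i, (M.adjugate i 0 : ℝ) + M.adjugate i 1 * (w 1 / w 0) +
      M.adjugate i 2 * (w 2 / w 0) = (M.det : ℝ) / w 0 * ![1, t, t ^ 2] i := fun i => by
    have := congrFun hadj i
    simpa only [Matrix.mulVec, dotProduct, Fin.sum_univ_three, Matrix.map_apply, Matrix.cons_val,
      Pi.smul_apply, smul_eq_mul, eq_intCast, mul_one] using this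
  obtain ⟨j, hj⟩ := exists_simApprox2_transfer M.adjugate (u := affinePoint w) (v := (t, t ^ 2))
    (c := (M.det : ℝ) / w 0) (div_ne_zero (by exact_mod_cast hM) hc)
    (by simpa [affinePoint] using hadj' 0) (by simpa [affinePoint] using hadj' 1)
    (by simpa [affinePoint] using hadj' 2) (ψ 1)
  exact ht j (hj ψ hψ le_rfl hmem)

lemma exists_int_matrix_map_eq_smul (A : Matrix (Fin 3) (Fin 3) ℚ) :
    ∃ (N : ℤ) (B : Matrix (Fin 3) (Fin 3) ℤ), N ≠ 0 ∧
      B.map (Int.castRingHom ℚ) = (N : ℚ) • A := by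
  obtain ⟨N, hN⟩ := IsLocalization.exist_integer_multiples (nonZeroDivisors ℤ)
    (Finset.univ : Finset (Fin 3 × Fin 3)) fun ij => A ij.1 ij.2
  choose B hB using fun i k => hN (i, k) (Finset.mem_univ _)
  refine ⟨N, Matrix.of B, nonZeroDivisors.coe_ne_zero N, ?_⟩
  ext i k
  have := hB i k
  rw [Matrix.map_apply, Matrix.of_apply, Matrix.smul_apply, smul_eq_mul]
  simpa [Algebra.smul_def] using this

lemma exists_conicPoint_of_standard {S : Set (ℝ × ℝ)}
    (hS : S = {p : ℝ × ℝ | p.1 ^ 2 + p.2 ^ 2 = 1} ∨ S = {p : ℝ × ℝ | p.2 = p.1 ^ 2} ∨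
      S = {p : ℝ × ℝ | p.1 ^ 2 - p.2 ^ 2 = 1}) :
    ∃ P : Matrix (Fin 3) (Fin 3) ℚ, P.det ≠ 0 ∧ ∃ s₀, ∀ s ∈ S, s = s₀ ∨
      ∃ t : ℝ, (P.map (Rat.castHom ℝ)).mulVec ![1, t, t ^ 2] 0 ≠ 0 ∧
        s = conicPoint (P.map (Rat.castHom ℝ)) t := by
  rcases hS with rfl | rfl | rfl
  · refine ⟨!![1, 0, 1; 1, 0, -1; 0, 2, 0], by simp [Matrix.det_fin_three], (-1, 0),
      fun ⟨x, y⟩ hs => ?_⟩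
    simp only [Set.mem_ofPred_eq] at hs
    by_cases hx : 1 + x = 0
    · left
      obtain rfl : x = -1 := by linarith
      have : y = 0 := by nlinarith
      rw [this]
    · right
      have h1 : 1 + (y / (1 + x)) ^ 2 ≠ 0 := by positivity
      refine ⟨y / (1 + x), by simpa [Matrix.mulVec, dotProduct, Fin.sum_univ_three] using h1, ?_⟩
      simp only [conicPoint, affinePoint, Matrix.mulVec, dotProduct, Fin.sum_univ_three]
      simp
      have h2 : 1 + (y / (1 + x)) ^ 2 = 2 / (1 + x) := by
        field_simp; linear_combination hs
      constructor
      · rw [h2]; field_simp; linear_combination hs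
      · rw [h2]; field_simp
  · refine ⟨1, by simp, (0, 0), fun ⟨x, y⟩ hs => Or.inr ⟨x, ?_, ?_⟩⟩
    · simp [Matrix.map_one]
    · simp only [Set.mem_ofPred_eq] at hs
      simp [conicPoint, affinePoint, Matrix.map_one, hs]
  · refine ⟨!![0, 2, 0; 1, 0, 1; -1, 0, 1], by simp [Matrix.det_fin_three], (0, 0),
      fun ⟨x, y⟩ hs => Or.inr ⟨x + y, ?_, ?_⟩⟩
    all_goals
      simp only [Set.mem_ofPred_eq] at hs
      have h1 : x + y ≠ 0 := fun h => by
        have : (x + y) * (x - y) = 1 := by linear_combination hs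
        rw [h, zero_mul] at this
        exact zero_ne_one this
    · simpa [Matrix.mulVec, dotProduct, Fin.sum_univ_three] using h1
    · simp only [conicPoint, affinePoint, Matrix.mulVec, dotProduct, Fin.sum_univ_three]
      simp
      constructor
      · field_simp; linear_combination hs
      · field_simp; linear_combination -hs

lemma IsRatQuadric.exists_conicPoint {Q : Set (ℝ × ℝ)} (hQ : IsRatQuadric Q) :
    ∃ M : Matrix (Fin 3) (Fin 3) ℤ, M.det ≠ 0 ∧ ∃ p₀, ∀ p ∈ Q, p = p₀ ∨
      ∃ t : ℝ, (M.map (Int.castRingHom ℝ)).mulVec ![1, t, t ^ 2] 0 ≠ 0 ∧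
        p = conicPoint (M.map (Int.castRingHom ℝ)) t := by
  obtain ⟨a, b, c, d, e, g, hdet, S, hS, rfl⟩ := hQ
  obtain ⟨P, hP, s₀, hs₀⟩ := exists_conicPoint_of_standard hS
  set T : Matrix (Fin 3) (Fin 3) ℚ := !![1, 0, 0; e, a, b; g, c, d] with hT
  have hTdet : T.det ≠ 0 := by
    rw [hT, Matrix.det_fin_three]
    simpa using hdet
  obtain ⟨N, M, hN, hM⟩ := exists_int_matrix_map_eq_smul (T * P)
  have hMR : M.map (Int.castRingHom ℝ) =
      (N : ℝ) • (T.map (Rat.castHom ℝ) * P.map (Rat.castHom ℝ)) := by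
    rw [← Matrix.map_mul]
    ext i k
    have := congrArg (Rat.cast : ℚ → ℝ) (congrFun (congrFun hM i) k)
    simpa using this
  have hTw : ∀ w : Fin 3 → ℝ, (T.map (Rat.castHom ℝ)).mulVec w =
      ![w 0, e * w 0 + a * w 1 + b * w 2, g * w 0 + c * w 1 + d * w 2] := fun w => by
    ext i
    fin_cases i <;> simp [hT, Matrix.mulVec, dotProduct, Fin.sum_univ_three]
  have hN' : (N : ℝ) ≠ 0 := by exact_mod_cast hN
  refine ⟨M, fun h0 => ?_, ((a : ℝ) * s₀.1 + b * s₀.2 + e, (c : ℝ) * s₀.1 + d * s₀.2 + g), ?_⟩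
  rotate_left
  · rintro _ ⟨s, hs, rfl⟩
    rcases hs₀ s hs with rfl | ⟨t, ht, rfl⟩
    · exact Or.inl rfl
    · refine Or.inr ⟨t, ?_, ?_⟩
      · rw [hMR, Matrix.smul_mulVec, ← Matrix.mulVec_mulVec, hTw]
        simpa using ⟨hN, ht⟩
      · rw [conicPoint, conicPoint, hMR, Matrix.smul_mulVec, affinePoint_smul hN',
          ← Matrix.mulVec_mulVec, hTw]
        simp only [affinePoint, Matrix.cons_val]
        ext <;> dsimp only <;> field_simp <;> ring
  · have h1 := congrArg Matrix.det hM
    rw [Matrix.det_smul, Matrix.det_mul, ← RingHom.mapMatrix_apply, ← RingHom.map_det, h0,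
      map_zero] at h1
    have h2 : (N : ℚ) ≠ 0 := by exact_mod_cast hN
    exact mul_ne_zero (pow_ne_zero _ h2) (mul_ne_zero hTdet hP) h1.symm

theorem rational_quadric_khintchine
    (Q : Set (ℝ × ℝ)) (hQ : IsRatQuadric Q)
    (ψ : ℝ → ℝ) (hψ : IsApproxFun ψ) :
    (Summable (fun h : ℕ => ψ h ^ 2) → μH[1] (Q ∩ SimApprox2 ψ) = 0) ∧
    (¬ Summable (fun h : ℕ => ψ h ^ 2) → μH[1] (Q \ SimApprox2 ψ) = 0) := by
  obtain ⟨M, hM, p₀, hp₀⟩ := hQ.exists_conicPoint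
  set γ := conicPoint (M.map (Int.castRingHom ℝ)) with hγ
  have key : ∀ R : Set (ℝ × ℝ), (∀ᵐ t : ℝ,
      (M.map (Int.castRingHom ℝ)).mulVec ![1, t, t ^ 2] 0 ≠ 0 → γ t ∉ R) → μH[1] (Q ∩ R) = 0 := by
    intro R hR
    have h1 : μH[1] (γ '' {t | ¬ ((M.map (Int.castRingHom ℝ)).mulVec ![1, t, t ^ 2] 0 ≠ 0 →
        γ t ∉ R)}) = 0 :=
      hausdorffMeasure_one_image_eq_zero (ae_iff.1 hR) fun t ht =>
        contDiffAt_conicPoint (Classical.not_imp.1 ht).1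
    have : NullSingletonClass (μH[1] : Measure (ℝ × ℝ)) :=
      Measure.nullSingletonClass_hausdorff _ one_pos
    refine measure_mono_null ?_ (measure_union_null (measure_singleton p₀) h1)
    rintro p ⟨hpQ, hpR⟩
    rcases hp₀ p hpQ with rfl | ⟨t, ht, rfl⟩
    · exact Or.inl rfl
    · exact Or.inr ⟨t, fun h => h ht hpR, rfl⟩
  exact ⟨fun hs => key _ (ae_conicPoint_notMem_simApprox2 hM hψ hs),
    fun hdiv => key _ ((ae_conicPoint_mem_simApprox2 M hψ hdiv).mono fun t ht h h' => h' (ht h))⟩
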